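/- arXiv:1806.04333 — 2 statements merged into one kernel-verified Lean document; each statement's English description precedes it below -/
import Mathlib

section
/- Let Z_1 = (ℝ^{k_1}, ‖·‖_{Z_1}) and Z_2 = (ℝ^{k_2}, ‖·‖_{Z_2}) be normed spaces and let Z_1 ⊕_1 Z_2 = (ℝ^{k_1+k_2}, ‖·‖) with ‖(z_1,z_2)‖ = ‖z_1‖_{Z_1} + ‖z_2‖_{Z_2}. Then the Lebesgue volume of the unit ball of Z_1 ⊕_1 Z_2 satisfies |B_{Z_1 ⊕_1 Z_2}| = (k_1! k_2! / (k_1+k_2)!) · |B_{Z_1}| · |B_{Z_2}|. -/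
open MeasureTheory Real
open scoped ENNReal

noncomputable section

/-- `N` is a norm on `ℝ^k`. -/
def IsNormOn (k : ℕ) (N : (Fin k → ℝ) → ℝ) : Prop :=
  (∀ x, N x = 0 ↔ x = 0) ∧ (∀ (a : ℝ) (x : Fin k → ℝ), N (a • x) = |a| * N x) ∧
    ∀ x y, N (x + y) ≤ N x + N y

/-- The unit ball of a norm `g` on an `n`-dimensional space has measure `(∫ exp (-g)) / n!`. -/
theorem measure_le_one_eq_integral_div_factorial {E : Type*} [AddCommGroup E] [Module ℝ E]
    [FiniteDimensional ℝ E] [MeasurableSpace E] [TopologicalSpace E] [IsTopologicalAddGroup E]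
    [BorelSpace E] [T2Space E] [ContinuousSMul ℝ E] (μ : Measure E) [μ.IsAddHaarMeasure]
    {g : E → ℝ} (eq_zero : ∀ x, g x = 0 ↔ x = 0) (smul : ∀ (a : ℝ) x, g (a • x) = |a| * g x)
    (add_le : ∀ x y, g (x + y) ≤ g x + g y) :
    μ {x | g x ≤ 1} =
      .ofReal ((∫ x, exp (-g x) ∂μ) / (Nat.factorial (Module.finrank ℝ E) : ℝ)) := by
  have h1 : g 0 = 0 := (eq_zero 0).2 rfl
  have h2 : ∀ x, g (-x) = g x := fun x ↦ by simpa using smul (-1) x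
  have hle : μ {x | g x ≤ 1} = μ {x | g x < 1} := by
    obtain hE | hE := subsingleton_or_nontrivial E
    · congr 1
      ext x
      simp [Subsingleton.elim x 0, h1]
    · exact measure_le_eq_lt μ h1 h2 add_le (fun {x} ↦ (eq_zero x).1) (fun a x ↦ (smul a x).le) 1
  rw [hle, measure_lt_one_eq_integral_div_gamma μ h1 h2 add_le (fun {x} ↦ (eq_zero x).1)
    (fun a x ↦ (smul a x).le) one_pos]
  simp [Real.Gamma_nat_eq_factorial]

theorem IsNormOn.nonneg {k : ℕ} {N : (Fin k → ℝ) → ℝ} (hN : IsNormOn k N) (x : Fin k → ℝ) :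
    0 ≤ N x := by
  have h0 : N 0 = 0 := (hN.1 0).2 rfl
  have hneg : N (-x) = N x := by simpa using hN.2.1 (-1) x
  have := hN.2.2 x (-x)
  rw [add_neg_cancel, h0, hneg] at this
  linarith

/-- **Volume of the unit ball of an `ℓ_1`-direct sum.** For normed spaces
`Z_1 = (ℝ^{k₁}, N₁)` and `Z_2 = (ℝ^{k₂}, N₂)`,
`|B_{Z₁ ⊕₁ Z₂}| = (k₁! k₂! / (k₁+k₂)!) |B_{Z₁}| |B_{Z₂}|`. -/
theorem volume_unit_ball_l1_sum (k₁ k₂ : ℕ)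
    (N₁ : (Fin k₁ → ℝ) → ℝ) (hN₁ : IsNormOn k₁ N₁)
    (N₂ : (Fin k₂ → ℝ) → ℝ) (hN₂ : IsNormOn k₂ N₂) :
    volume {z : (Fin k₁ → ℝ) × (Fin k₂ → ℝ) | N₁ z.1 + N₂ z.2 ≤ 1} =
      ENNReal.ofReal ((Nat.factorial k₁ : ℝ) * (Nat.factorial k₂ : ℝ) /
          (Nat.factorial (k₁ + k₂) : ℝ)) *
        volume {z₁ : Fin k₁ → ℝ | N₁ z₁ ≤ 1} * volume {z₂ : Fin k₂ → ℝ | N₂ z₂ ≤ 1} := by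
  have : ((volume : Measure (Fin k₁ → ℝ)).prod (volume : Measure (Fin k₂ → ℝ))).IsAddHaarMeasure :=
    Measure.prod.instIsAddHaarMeasure _ _
  have hsum := measure_le_one_eq_integral_div_factorial
    ((volume : Measure (Fin k₁ → ℝ)).prod (volume : Measure (Fin k₂ → ℝ))) (g := fun z ↦ N₁ z.1 + N₂ z.2)
    (fun z ↦ by
      rw [add_eq_zero_iff_of_nonneg (hN₁.nonneg _) (hN₂.nonneg _), hN₁.1, hN₂.1, Prod.ext_iff]
      rfl)
    (fun a z ↦ by simp [hN₁.2.1, hN₂.2.1, mul_add])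
    (fun x y ↦ by
      have := hN₁.2.2 x.1 y.1
      have := hN₂.2.2 x.2 y.2
      simp only [Prod.fst_add, Prod.snd_add]
      linarith)
  have hint : ∫ z : (Fin k₁ → ℝ) × (Fin k₂ → ℝ), exp (-(N₁ z.1 + N₂ z.2)) ∂(volume.prod volume) =
      (∫ x, exp (-N₁ x)) * ∫ y, exp (-N₂ y) := by
    simp_rw [neg_add, exp_add]
    exact integral_prod_mul (fun x ↦ exp (-N₁ x)) (fun y ↦ exp (-N₂ y))
  have I₁_nonneg : 0 ≤ ∫ x, exp (-N₁ x) := integral_nonneg fun _ ↦ (exp_pos _).le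
  rw [Measure.volume_eq_prod, hsum, hint,
    measure_le_one_eq_integral_div_factorial volume hN₁.1 hN₁.2.1 hN₁.2.2,
    measure_le_one_eq_integral_div_factorial volume hN₂.1 hN₂.2.1 hN₂.2.2,
    ← ENNReal.ofReal_mul (by positivity), ← ENNReal.ofReal_mul (by positivity)]
  simp only [Module.finrank_prod, Module.finrank_fin_fun]
  congr 1
  field_simp
end
end

section
/- Let m, n ∈ ℕ and 2 ≤ q ≤ p ≤ ∞. Then for every unit vector θ in ℝ^n: |B_p^n(ℓ_q^m) ∩ H_θ| ≥ |B_p^{n−1}(ℓ_q^m)|, where the left-hand side is the (m(n−1))-dimensional Lebesgue measure of the section and the right-hand side the volume of B_p^{n−1}(ℓ_q^m). In particular, for every q ∈ [2,∞], the set K = B_q^m(ℝ) satisfies |K^n ∩ H_θ| ≥ |K|^{n−1} for every unit vector θ in ℝ^n. -/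
open MeasureTheory Real Filter
open scoped ENNReal

noncomputable section

/-- `N` is a quasi-norm on `ℝ^m`. -/
def IsQuasiNorm (m : ℕ) (N : (Fin m → ℝ) → ℝ) : Prop :=
  (∀ x, 0 ≤ N x) ∧ (∀ x, N x = 0 ↔ x = 0) ∧
    (∀ (a : ℝ) (x : Fin m → ℝ), N (a • x) = |a| * N x) ∧
    ∃ C : ℝ, 1 ≤ C ∧ ∀ x y, N (x + y) ≤ C * (N x + N y)

/-- `X = (ℝ^m, N)` admits an isometric embedding into some `L_p(μ)` space:
there are a measure space `(Ω, μ)` and a linear map `T : ℝ^m → L_p(μ)` with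
`‖T x‖_{L_p(μ)} = N x` for every `x`. -/
def EmbedsIntoLp (m : ℕ) (p : ℝ) (N : (Fin m → ℝ) → ℝ) : Prop :=
  ∃ (Ω : Type) (_ : MeasurableSpace Ω) (μ : Measure Ω) (T : (Fin m → ℝ) →ₗ[ℝ] (Ω → ℝ)),
    (∀ x, Integrable (fun ω => |T x ω| ^ p) μ) ∧
    ∀ x, (∫ ω, |T x ω| ^ p ∂μ) ^ (1 / p) = N x

/-- `α` is majorized by `β`: for every `k`, the sum of the `k` largest entries of `α` is at
most that of `β` (expressed via finite subsets: the sum of the `k` largest entries is the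
maximum of `∑ i ∈ A, · i` over sets `A` of cardinality `k`), and the total sums agree. -/
def IsMajorizedBy {n : ℕ} (α β : Fin n → ℝ) : Prop :=
  (∀ A : Finset (Fin n), ∃ B : Finset (Fin n), B.card = A.card ∧ ∑ i ∈ A, α i ≤ ∑ i ∈ B, β i) ∧
    ∑ i, α i = ∑ i, β i

/-- The unit ball `B_p^n(X)` of `ℓ_p^n(X)` for `X = (ℝ^m, N)` and `0 < p < ∞`. -/
def lpBall (m n : ℕ) (p : ℝ) (N : (Fin m → ℝ) → ℝ) : Set (Fin n × Fin m → ℝ) :=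
  {x | ∑ i : Fin n, N (fun j => x (i, j)) ^ p ≤ 1}

/-- The block hyperplane `H_θ = {(x_1,…,x_n) ∈ (ℝ^m)^n : ∑ θ_i x_i = 0}`. -/
def blockHyp (m n : ℕ) (θ : Fin n → ℝ) : Set (Fin n × Fin m → ℝ) :=
  {x | ∀ j : Fin m, ∑ i : Fin n, θ i * x (i, j) = 0}

/-- `ι` is a linear isometric parametrization (w.r.t. the Euclidean structures) of the
subspace `H` of `ℝ^{mn} = (ℝ^m)^n` by `ℝ^d`; for `A ⊆ H`, `volume (⇑ι ⁻¹' A)` is then the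
`d`-dimensional Lebesgue measure of `A` inside `H`. -/
def IsEuclParam (m n d : ℕ) (ι : (Fin d → ℝ) →ₗ[ℝ] (Fin n × Fin m → ℝ))
    (H : Set (Fin n × Fin m → ℝ)) : Prop :=
  (∀ y, ∑ c, ι y c ^ 2 = ∑ i, y i ^ 2) ∧ Set.range ⇑ι = H

/-- The unit ball `B_p^n(X)` of `ℓ_p^n(X)` for `X = (ℝ^m, N)` and `p ∈ (0,∞]`
(for `p = ∞` it is the product `B_X^n`). -/
def lpBallE (m n : ℕ) (p : ℝ≥0∞) (N : (Fin m → ℝ) → ℝ) : Set (Fin n × Fin m → ℝ) :=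
  if p = ⊤ then {x | ∀ i : Fin n, N (fun j => x (i, j)) ≤ 1}
  else {x | ∑ i : Fin n, N (fun j => x (i, j)) ^ p.toReal ≤ 1}

/-- The `ℓ_q` norm on `ℝ^m` for `q ∈ (0,∞]` (the max norm for `q = ∞`). -/
def lqNormE (m : ℕ) (q : ℝ≥0∞) (x : Fin m → ℝ) : ℝ :=
  if q = ⊤ then ⨆ j, |x j| else (∑ j, |x j| ^ q.toReal) ^ (1 / q.toReal)

/-- Log-concavity of an extended nonnegative function on a real vector space. -/
def LogConc {A : Type*} [AddCommGroup A] [Module ℝ A] (g : A → ℝ≥0∞) : Prop :=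
  ∀ (x y : A) (a b : ℝ), 0 < a → 0 < b → a + b = 1 → g x ^ a * g y ^ b ≤ g (a • x + b • y)

theorem ENNReal_geom_mean_le_arith_mean (X Y : ℝ≥0∞) {a b : ℝ} (ha : 0 < a) (hb : 0 < b)
    (hab : a + b = 1) : X ^ a * Y ^ b ≤ ENNReal.ofReal a * X + ENNReal.ofReal b * Y := by
  have hc : (a⁻¹).HolderConjugate b⁻¹ := by
    rw [Real.holderConjugate_iff]
    refine ⟨(one_lt_inv₀ ha).2 (by linarith), by simpa using hab⟩
  have h := ENNReal.young_inequality (X ^ a) (Y ^ b) hc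
  rw [← ENNReal.rpow_mul, ← ENNReal.rpow_mul, mul_inv_cancel₀ ha.ne', mul_inv_cancel₀ hb.ne',
    ENNReal.rpow_one, ENNReal.rpow_one, ENNReal.ofReal_inv_of_pos ha,
    ENNReal.ofReal_inv_of_pos hb, div_eq_mul_inv, div_eq_mul_inv, inv_inv, inv_inv] at h
  rwa [mul_comm (ENNReal.ofReal a), mul_comm (ENNReal.ofReal b)]

theorem volume_convex_comb_le {S T U : Set ℝ} (hSne : S.Nonempty) (hTne : T.Nonempty)
    (hU : U.OrdConnected) {a b : ℝ} (ha : 0 < a) (hb : 0 < b)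
    (h : ∀ x ∈ S, ∀ y ∈ T, a * x + b * y ∈ U) :
    ENNReal.ofReal a * volume S + ENNReal.ofReal b * volume T ≤ volume U := by
  have key : ∀ x ∈ S, ∀ x' ∈ S, ∀ y ∈ T, ∀ y' ∈ T,
      ENNReal.ofReal a * edist x x' + ENNReal.ofReal b * edist y y' ≤ volume U := by
    intro x hx x' hx' y hy y' hy'
    wlog hxx : x ≤ x' generalizing x x'
    · rw [edist_comm x]; exact this x' hx' x hx (le_of_not_ge hxx)
    wlog hyy : y ≤ y' generalizing y y'
    · rw [edist_comm y]; exact this y' hy' y hy (le_of_not_ge hyy)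
    rw [edist_comm, edist_dist, Real.dist_eq, abs_of_nonneg (by linarith), edist_comm y,
      edist_dist, Real.dist_eq, abs_of_nonneg (by linarith), ← ENNReal.ofReal_mul ha.le,
      ← ENNReal.ofReal_mul hb.le, ← ENNReal.ofReal_add (by nlinarith) (by nlinarith)]
    have := measure_mono (μ := volume) (hU.out (h x hx y hy) (h x' hx' y' hy'))
    rw [Real.volume_Icc] at this
    convert this using 2
    ring
  have hdiam : ∀ (S : Set ℝ), S.Nonempty →
      Metric.ediam S = ⨆ p : S × S, edist (p.1 : ℝ) p.2 := by
    intro S hS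
    apply le_antisymm
    · exact Metric.ediam_le fun x hx y hy =>
        le_iSup (fun p : S × S => edist (p.1 : ℝ) p.2) (⟨x, hx⟩, ⟨y, hy⟩)
    · exact iSup_le fun p => Metric.edist_le_ediam_of_mem p.1.2 p.2.2
  refine (add_le_add (mul_le_mul_right (Real.volume_le_diam S) _)
    (mul_le_mul_right (Real.volume_le_diam T) _)).trans ?_
  have := hSne.to_subtype
  have := hTne.to_subtype
  rw [hdiam S hSne, hdiam T hTne, ENNReal.mul_iSup, ENNReal.mul_iSup]
  exact ENNReal.iSup_add_iSup_le fun p r =>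
    key _ p.1.2 _ p.2.2 _ r.1.2 _ r.2.2

theorem prekopa_leindler_normalized {f g h : ℝ → ℝ} (hf0 : ∀ x, 0 ≤ f x) (hg0 : ∀ x, 0 ≤ g x)
    (hh0 : ∀ x, 0 ≤ h x) (hf : Measurable f) (hg : Measurable g) (hh : Measurable h)
    (hf1 : ∀ x, f x ≤ 1) (hg1 : ∀ x, g x ≤ 1)
    (hfs : ∀ s < 1, ∃ x, s < f x) (hgs : ∀ s < 1, ∃ x, s < g x)
    (hconv : ∀ s, {x | s < h x}.OrdConnected) {a b : ℝ} (ha : 0 < a) (hb : 0 < b)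
    (hab : a + b = 1) (H : ∀ x y, f x ^ a * g y ^ b ≤ h (a * x + b * y)) :
    ENNReal.ofReal a * (∫⁻ x, ENNReal.ofReal (f x)) +
      ENNReal.ofReal b * (∫⁻ x, ENNReal.ofReal (g x)) ≤ ∫⁻ x, ENNReal.ofReal (h x) := by
  rw [lintegral_eq_lintegral_meas_lt _ (Eventually.of_forall hf0) hf.aemeasurable,
    lintegral_eq_lintegral_meas_lt _ (Eventually.of_forall hg0) hg.aemeasurable,
    lintegral_eq_lintegral_meas_lt _ (Eventually.of_forall hh0) hh.aemeasurable,
    ← lintegral_const_mul' _ _ ENNReal.ofReal_ne_top,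
    ← lintegral_const_mul' _ _ ENNReal.ofReal_ne_top, ← lintegral_add_left]
  · refine setLIntegral_mono' measurableSet_Ioi fun s hs => ?_
    have hs : 0 < s := hs
    by_cases hs1 : s < 1
    · refine volume_convex_comb_le (hfs s hs1) (hgs s hs1) (hconv s) ha hb fun x hx y hy => ?_
      refine lt_of_lt_of_le ?_ (H x y)
      have hx : s < f x := hx
      have hy : s < g y := hy
      calc s = s ^ a * s ^ b := by rw [← Real.rpow_add hs, hab, Real.rpow_one]
        _ < f x ^ a * g y ^ b := by
          exact mul_lt_mul'' (Real.rpow_lt_rpow hs.le hx ha) (Real.rpow_lt_rpow hs.le hy hb)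
            (by positivity) (by positivity)
    · have e1 : {x | s < f x} = ∅ := by
        ext x; simp only [Set.mem_ofPred_eq, Set.mem_empty_iff_false, iff_false]
        have := hf1 x; linarith
      have e2 : {x | s < g x} = ∅ := by
        ext x; simp only [Set.mem_ofPred_eq, Set.mem_empty_iff_false, iff_false]
        have := hg1 x; linarith
      simp [e1, e2]
  · refine Measurable.const_mul ?_ _
    exact (Antitone.measurable fun s t hst => measure_mono fun x hx => lt_of_le_of_lt hst hx)

theorem prekopa_leindler_bounded {f g h : ℝ → ℝ} (hf0 : ∀ x, 0 ≤ f x) (hg0 : ∀ x, 0 ≤ g x)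
    (hh0 : ∀ x, 0 ≤ h x) (hf : Measurable f) (hg : Measurable g) (hh : Measurable h)
    {M : ℝ} (hf1 : ∀ x, f x ≤ M) (hg1 : ∀ x, g x ≤ M)
    (hconv : ∀ s, {x | s < h x}.OrdConnected) {a b : ℝ} (ha : 0 < a) (hb : 0 < b)
    (hab : a + b = 1) (H : ∀ x y, f x ^ a * g y ^ b ≤ h (a * x + b * y)) :
    (∫⁻ x, ENNReal.ofReal (f x)) ^ a * (∫⁻ x, ENNReal.ofReal (g x)) ^ b
      ≤ ∫⁻ x, ENNReal.ofReal (h x) := by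
  have bddf : BddAbove (Set.range f) := ⟨M, by rintro _ ⟨x, rfl⟩; exact hf1 x⟩
  have bddg : BddAbove (Set.range g) := ⟨M, by rintro _ ⟨x, rfl⟩; exact hg1 x⟩
  set A := ⨆ x, f x with hA
  set B := ⨆ x, g x with hB
  have hfA : ∀ x, f x ≤ A := le_ciSup bddf
  have hgB : ∀ x, g x ≤ B := le_ciSup bddg
  have hA0 : 0 ≤ A := (hf0 0).trans (hfA 0)
  have hB0 : 0 ≤ B := (hg0 0).trans (hgB 0)
  rcases hA0.eq_or_lt with hA0 | hA0
  · have : ∀ x, f x = 0 := fun x => le_antisymm (by rw [hA0]; exact hfA x) (hf0 x)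
    simp [this, ENNReal.zero_rpow_of_pos ha]
  rcases hB0.eq_or_lt with hB0 | hB0
  · have : ∀ x, g x = 0 := fun x => le_antisymm (by rw [hB0]; exact hgB x) (hg0 x)
    simp [this, ENNReal.zero_rpow_of_pos hb]
  have hC : 0 < A ^ a * B ^ b := by positivity
  have key := prekopa_leindler_normalized (f := fun x => A⁻¹ * f x) (g := fun x => B⁻¹ * g x)
    (h := fun x => (A ^ a * B ^ b)⁻¹ * h x)
    (fun x => mul_nonneg (by positivity) (hf0 x)) (fun x => mul_nonneg (by positivity) (hg0 x))
    (fun x => mul_nonneg (by positivity) (hh0 x))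
    (hf.const_mul _) (hg.const_mul _) (hh.const_mul _)
    (fun x => (inv_mul_le_one₀ hA0).2 (hfA x)) (fun x => (inv_mul_le_one₀ hB0).2 (hgB x))
    (fun s hs => by
      obtain ⟨x, hx⟩ := exists_lt_of_lt_ciSup (show A * s < ⨆ x, f x by nlinarith)
      exact ⟨x, by rwa [lt_inv_mul_iff₀ hA0]⟩)
    (fun s hs => by
      obtain ⟨x, hx⟩ := exists_lt_of_lt_ciSup (show B * s < ⨆ x, g x by nlinarith)
      exact ⟨x, by rwa [lt_inv_mul_iff₀ hB0]⟩)
    (fun s => by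
      convert hconv (A ^ a * B ^ b * s) using 2 with x
      exact funext fun x => propext (lt_inv_mul_iff₀ hC))
    ha hb hab (fun x y => by
      rw [Real.mul_rpow (by positivity) (hf0 x), Real.mul_rpow (by positivity) (hg0 y),
        Real.inv_rpow hA0.le, Real.inv_rpow hB0.le, mul_inv, mul_mul_mul_comm]
      exact mul_le_mul_of_nonneg_left (H x y) (by positivity))
  have e : ∀ {c : ℝ}, 0 < c → ∀ k : ℝ → ℝ,
      ∫⁻ x, ENNReal.ofReal (c⁻¹ * k x) = ENNReal.ofReal c⁻¹ * ∫⁻ x, ENNReal.ofReal (k x) := by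
    intro c hc k
    rw [← lintegral_const_mul' _ _ ENNReal.ofReal_ne_top]
    exact lintegral_congr fun x => ENNReal.ofReal_mul (by positivity)
  rw [e hA0, e hB0, e hC] at key
  have key := (ENNReal_geom_mean_le_arith_mean _ _ ha hb hab).trans key
  rw [ENNReal.mul_rpow_of_nonneg _ _ ha.le, ENNReal.mul_rpow_of_nonneg _ _ hb.le,
    ENNReal.ofReal_rpow_of_nonneg (by positivity) ha.le,
    ENNReal.ofReal_rpow_of_nonneg (by positivity) hb.le, mul_mul_mul_comm,
    ← ENNReal.ofReal_mul (by positivity), Real.inv_rpow hA0.le, Real.inv_rpow hB0.le,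
    ← mul_inv] at key
  exact (ENNReal.mul_le_mul_iff_right (ENNReal.ofReal_pos.2 (inv_pos.2 hC)).ne' ENNReal.ofReal_ne_top).1 key

/-- Integrating out a `V`-valued variable preserves log-concavity. -/
def IntegralLogConc (V : Type) [AddCommGroup V] [Module ℝ V] [MeasureSpace V] : Prop :=
  ∀ (A : Type) [AddCommGroup A] [Module ℝ A] (G : A × V → ℝ≥0∞),
    (∀ x, Measurable fun v => G (x, v)) → LogConc G → LogConc fun x => ∫⁻ v, G (x, v)

theorem LogConc.min_const {A : Type*} [AddCommGroup A] [Module ℝ A] {g : A → ℝ≥0∞}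
    (hg : LogConc g) (M : ℝ≥0∞) : LogConc fun x => min (g x) M := by
  intro x y a b ha hb hab
  refine le_min ((mul_le_mul' (ENNReal.rpow_le_rpow (min_le_left _ _) ha.le)
    (ENNReal.rpow_le_rpow (min_le_left _ _) hb.le)).trans (hg x y a b ha hb hab)) ?_
  refine (mul_le_mul' (ENNReal.rpow_le_rpow (min_le_right _ _) ha.le)
    (ENNReal.rpow_le_rpow (min_le_right _ _) hb.le)).trans ?_
  rw [← ENNReal.rpow_add_of_nonneg _ _ ha.le hb.le, hab, ENNReal.rpow_one]

theorem LogConc.lt_of_lt {A : Type*} [AddCommGroup A] [Module ℝ A] {g : A → ℝ≥0∞}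
    (hg : LogConc g) {s : ℝ≥0∞} {x y : A} (hx : s < g x) (hy : s < g y) {a b : ℝ} (ha : 0 < a)
    (hb : 0 < b) (hab : a + b = 1) : s < g (a • x + b • y) := by
  refine lt_of_lt_of_le ?_ (hg x y a b ha hb hab)
  calc s = s ^ a * s ^ b := by
        rw [← ENNReal.rpow_add_of_nonneg _ _ ha.le hb.le, hab, ENNReal.rpow_one]
    _ < _ := ENNReal.mul_lt_mul (ENNReal.rpow_lt_rpow hx ha) (ENNReal.rpow_lt_rpow hy hb)

theorem LogConc.comp_linear {A B : Type*} [AddCommGroup A] [Module ℝ A] [AddCommGroup B]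
    [Module ℝ B] {g : B → ℝ≥0∞} (hg : LogConc g) (L : A →ₗ[ℝ] B) : LogConc fun x => g (L x) := by
  intro x y a b ha hb hab
  simpa using hg (L x) (L y) a b ha hb hab

theorem integralLogConc_real : IntegralLogConc ℝ := by
  intro A _ _ G hG hlc
  have bdd : ∀ M : ℕ, LogConc fun x => ∫⁻ v, min (G (x, v)) M := by
    intro M x y a b ha hb hab
    have hlcM := hlc.min_const (M : ℝ≥0∞)
    have hne : ∀ z, min (G z) M ≠ ∞ := fun z => ne_top_of_le_ne_top (by simp) (min_le_right _ _)
    have hm : ∀ z, Measurable fun t : ℝ => (min (G (z, t)) M).toReal :=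
      fun z => ((hG z).min measurable_const).ennreal_toReal
    have hle : ∀ z, (min (G z) M).toReal ≤ M := fun z =>
      (ENNReal.toReal_mono (by simp) (min_le_right _ _)).trans (by simp)
    have key := prekopa_leindler_bounded
      (f := fun t => (min (G (x, t)) M).toReal) (g := fun t => (min (G (y, t)) M).toReal)
      (h := fun t => (min (G (a • x + b • y, t)) M).toReal) (M := M)
      (fun _ => ENNReal.toReal_nonneg) (fun _ => ENNReal.toReal_nonneg)
      (fun _ => ENNReal.toReal_nonneg) (hm _) (hm _) (hm _) (fun _ => hle _) (fun _ => hle _)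
      (fun s => by
        rcases lt_or_ge s 0 with hs | hs
        · convert Set.ordConnected_univ
          exact Set.eq_univ_of_forall fun t => hs.trans_le ENNReal.toReal_nonneg
        · have : Convex ℝ {t : ℝ | ENNReal.ofReal s < min (G (a • x + b • y, t)) M} := by
            refine convex_iff_forall_pos.2 fun t ht u hu c d hc hd hcd => ?_
            have := hlcM.lt_of_lt (x := (a • x + b • y, t)) (y := (a • x + b • y, u))
              ht hu hc hd hcd
            rw [Prod.smul_mk, Prod.smul_mk, Prod.mk_add_mk, ← add_smul, hcd, one_smul] at this
            exact this
          have hset : {t : ℝ | s < (min (G (a • x + b • y, t)) M).toReal} =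
              {t : ℝ | ENNReal.ofReal s < min (G (a • x + b • y, t)) M} :=
            Set.ext fun t => (ENNReal.ofReal_lt_iff_lt_toReal hs (hne _)).symm
          rw [hset]
          exact this.ordConnected)
      ha hb hab (fun t u => by
        rw [ENNReal.toReal_rpow, ENNReal.toReal_rpow, ← ENNReal.toReal_mul]
        exact ENNReal.toReal_mono (hne _) (hlcM (x, t) (y, u) a b ha hb hab))
    simpa only [ENNReal.ofReal_toReal (hne _)] using key
  have hsup : ∀ x, ∫⁻ v, G (x, v) = ⨆ M : ℕ, ∫⁻ v, min (G (x, v)) M := by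
    intro x
    rw [← lintegral_iSup (fun M => (hG x).min measurable_const)]
    · refine lintegral_congr fun v => ?_
      rw [← inf_iSup_eq, ENNReal.iSup_natCast, inf_top_eq]
    · intro M N hMN v
      exact min_le_min_left _ (by exact_mod_cast hMN)
  have hmono : ∀ z, Monotone fun M : ℕ => ∫⁻ v, min (G (z, v)) M := fun z M N hMN =>
    lintegral_mono fun v => min_le_min_left _ (by exact_mod_cast hMN)
  intro x y a b ha hb hab
  have hpow : ∀ z {c : ℝ}, 0 < c → (∫⁻ v, G (z, v)) ^ c
      = ⨆ M : ℕ, (∫⁻ v, min (G (z, v)) M) ^ c := by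
    intro z c hc
    rw [hsup z]
    exact (ENNReal.orderIsoRpow c hc).map_iSup _
  simp only
  rw [hpow x ha, hpow y hb, ENNReal.iSup_mul, hsup (a • x + b • y)]
  refine iSup_le fun M => ?_
  rw [ENNReal.mul_iSup]
  refine iSup_le fun N => le_iSup_of_le (max M N) ?_
  exact (mul_le_mul' (ENNReal.rpow_le_rpow (hmono x (le_max_left M N)) ha.le)
    (ENNReal.rpow_le_rpow (hmono y (le_max_right M N)) hb.le)).trans
    (bdd (max M N) x y a b ha hb hab)

theorem LogConc.mul {A : Type*} [AddCommGroup A] [Module ℝ A] {g h : A → ℝ≥0∞}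
    (hg : LogConc g) (hh : LogConc h) : LogConc fun x => g x * h x := by
  intro x y a b ha hb hab
  simp only
  rw [ENNReal.mul_rpow_of_nonneg _ _ ha.le, ENNReal.mul_rpow_of_nonneg _ _ hb.le,
    mul_mul_mul_comm]
  exact mul_le_mul' (hg x y a b ha hb hab) (hh x y a b ha hb hab)

theorem LogConc.prod_pi {V : Type*} [AddCommGroup V] [Module ℝ V] {g : V → ℝ≥0∞}
    (hg : LogConc g) {ι : Type*} (s : Finset ι) : LogConc fun x : ι → V => ∏ i ∈ s, g (x i) := by
  classical
  induction s using Finset.induction_on with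
  | empty => intro x y a b _ _ _; simp
  | insert i s hi ih =>
    simp only [Finset.prod_insert hi]
    exact (hg.comp_linear (LinearMap.proj i)).mul ih

theorem LogConc.le_smul {A : Type*} [AddCommGroup A] [Module ℝ A] {g : A → ℝ≥0∞}
    (hg : LogConc g) (heven : ∀ x, g (-x) = g x) (x : A) {s : ℝ} (hs0 : 0 ≤ s) (hs1 : s ≤ 1) :
    g x ≤ g (s • x) := by
  rcases hs1.eq_or_lt with rfl | hs1
  · simp
  have h := hg x (-x) ((1 + s) / 2) ((1 - s) / 2) (by linarith) (by linarith) (by ring)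
  rw [heven, ← ENNReal.rpow_add_of_nonneg _ _ (by linarith) (by linarith), smul_neg,
    ← sub_eq_add_neg, ← sub_smul] at h
  convert h using 1
  · rw [← add_div]; ring_nf; simp
  · ring_nf

theorem lintegral_fin_succ {V : Type} [MeasureSpace V] [SigmaFinite (volume : Measure V)] {n : ℕ}
    {g : (Fin (n + 1) → V) → ℝ≥0∞} (hg : Measurable g) :
    ∫⁻ v, g v = ∫⁻ a : V, ∫⁻ b : Fin n → V, g (Fin.cons a b) := by
  have hmp := (volume_preserving_piFinSuccAbove (fun _ : Fin (n + 1) => V) 0).symm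
  rw [← hmp.lintegral_comp hg]
  have hm := hg.comp (MeasurableEquiv.piFinSuccAbove (fun _ : Fin (n + 1) => V) 0).symm.measurable
  refine (lintegral_prod (μ := (volume : Measure V)) (ν := (volume : Measure (Fin n → V))) _
    hm.aemeasurable).trans (lintegral_congr fun a => lintegral_congr fun b => ?_)
  exact congrArg g (Fin.insertNth_zero' a b)

theorem measurable_fin_cons {V : Type} [MeasurableSpace V] {n : ℕ} :
    Measurable fun p : V × (Fin n → V) => (Fin.cons p.1 p.2 : Fin (n + 1) → V) := by
  refine measurable_pi_lambda _ fun i => ?_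
  induction i using Fin.cases with
  | zero => simpa using measurable_fst
  | succ i => exact (measurable_pi_apply i).comp measurable_snd

theorem fin_cons_smul_add_smul {V : Type*} [AddCommGroup V] [Module ℝ V] {n : ℕ} (a b : ℝ)
    (x y : V) (u v : Fin n → V) : (Fin.cons (a • x + b • y) (a • u + b • v) : Fin (n + 1) → V) =
      a • (Fin.cons x u : Fin (n + 1) → V) + b • (Fin.cons y v : Fin (n + 1) → V) := by
  ext i
  induction i using Fin.cases <;> simp

theorem lintegral_prod_pi {V : Type} [MeasureSpace V] [SigmaFinite (volume : Measure V)] (n : ℕ)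
    {g : V → ℝ≥0∞} (hg : Measurable g) :
    ∫⁻ v : Fin n → V, ∏ i, g (v i) = (∫⁻ v, g v) ^ n := by
  induction n with
  | zero => simp [lintegral_unique, volume_pi]
  | succ n ih =>
    rw [lintegral_fin_succ (g := fun v => ∏ i, g (v i))
      (Finset.measurable_prod _ fun i _ => hg.comp (measurable_pi_apply i))]
    simp only [Fin.prod_univ_succ, Fin.cons_zero, Fin.cons_succ]
    have hm : Measurable fun v : Fin n → V => ∏ i, g (v i) :=
      Finset.measurable_prod _ fun i _ => hg.comp (measurable_pi_apply i)
    simp_rw [lintegral_const_mul _ hm, ih]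
    rw [lintegral_mul_const _ hg, pow_succ']

/-- `φ` is more peaked than `ψ`, tested against even log-concave functions. -/
def Peaked {V : Type*} [AddCommGroup V] [Module ℝ V] [MeasureSpace V] (φ ψ : V → ℝ≥0∞) : Prop :=
  ∀ F : V → ℝ≥0∞, Measurable F → (∀ x, F (-x) = F x) → LogConc F → (∀ x, F x ≤ 1) →
    ∫⁻ x, F x * ψ x ≤ ∫⁻ x, F x * φ x

theorem Peaked.trans {V : Type*} [AddCommGroup V] [Module ℝ V] [MeasureSpace V]
    {φ ψ χ : V → ℝ≥0∞} (h : Peaked φ ψ) (h' : Peaked ψ χ) : Peaked φ χ :=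
  fun F hF he hlc h1 => (h' F hF he hlc h1).trans (h F hF he hlc h1)

theorem IntegralLogConc.pi {V : Type} [AddCommGroup V] [Module ℝ V] [MeasureSpace V]
    [SigmaFinite (volume : Measure V)] (hV : IntegralLogConc V) (n : ℕ) : IntegralLogConc (Fin n → V) := by
  induction n with
  | zero =>
    intro A _ _ G hG hlc
    have : ∀ x, ∫⁻ v : Fin 0 → V, G (x, v) = G (x, 0) := by
      intro x
      simp [lintegral_unique, volume_pi, Subsingleton.elim default (0 : Fin 0 → V)]
    simp only [this]
    exact hlc.comp_linear (LinearMap.inl ℝ A (Fin 0 → V))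
  | succ n ih =>
    intro A _ _ G hG hlc
    have h1 : LogConc fun p : A × V => ∫⁻ b : Fin n → V, G (p.1, Fin.cons p.2 b) := by
      refine ih (A × V) (fun q => G (q.1.1, Fin.cons q.1.2 q.2)) (fun x => ?_) ?_
      · exact (hG x.1).comp
          (measurable_fin_cons.comp (measurable_prodMk_left (x := x.2)))
      · intro x y a b ha hb hab
        have := hlc (x.1.1, Fin.cons x.1.2 x.2) (y.1.1, Fin.cons y.1.2 y.2) a b ha hb hab
        rw [Prod.smul_mk, Prod.smul_mk, Prod.mk_add_mk, ← fin_cons_smul_add_smul] at this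
        exact this
    have h2 := hV A (fun p : A × V => ∫⁻ b : Fin n → V, G (p.1, Fin.cons p.2 b)) (fun x =>
      ((hG x).comp measurable_fin_cons).lintegral_prod_right') h1
    simp only [fun x => lintegral_fin_succ (hG x)]
    exact h2

section

variable {V : Type} [NormedAddCommGroup V] [NormedSpace ℝ V] [FiniteDimensional ℝ V]
  [MeasureSpace V] [BorelSpace V] [(volume : Measure V).IsAddHaarMeasure]

theorem Peaked.pi (hV : IntegralLogConc V) {φ ψ : V → ℝ≥0∞} (h : Peaked φ ψ)
    (hφm : Measurable φ) (hψm : Measurable ψ) (hφe : ∀ x, φ (-x) = φ x) (hψe : ∀ x, ψ (-x) = ψ x)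
    (hφ : LogConc φ) (hψ : LogConc ψ) (hφ1 : ∫⁻ x, φ x ≤ 1) (hψ1 : ∫⁻ x, ψ x ≤ 1) (n : ℕ) :
    Peaked (fun x : Fin n → V => ∏ i, φ (x i)) (fun x : Fin n → V => ∏ i, ψ (x i)) := by
  induction n with
  | zero => intro F _ _ _ _; simp
  | succ n ih =>
    intro F hF he hlc h1
    have hpm : ∀ {χ : V → ℝ≥0∞}, Measurable χ → ∀ k, Measurable fun x : Fin k → V => ∏ i, χ (x i) :=
      fun hχ k => Finset.measurable_prod _ fun i _ => hχ.comp (measurable_pi_apply i)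
    have hFc : Measurable fun p : V × (Fin n → V) => F (Fin.cons p.1 p.2) :=
      hF.comp measurable_fin_cons
    have hlcc : LogConc fun p : V × (Fin n → V) => F (Fin.cons p.1 p.2) := by
      intro x y a b ha hb hab
      have := hlc (Fin.cons x.1 x.2) (Fin.cons y.1 y.2) a b ha hb hab
      rw [← fin_cons_smul_add_smul] at this
      exact this
    have hneg : ∀ (x : V) (y : Fin n → V), F (Fin.cons (-x) (-y)) = F (Fin.cons x y) := by
      intro x y
      rw [← he]
      congr 1
      ext i
      induction i using Fin.cases <;> simp
    have step1 := h (fun x => ∫⁻ y : Fin n → V, F (Fin.cons x y) * ∏ i, ψ (y i))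
      ((hFc.mul ((hpm hψm n).comp measurable_snd)).lintegral_prod_right')
      (fun x => by
        rw [← lintegral_neg_eq_self]
        refine lintegral_congr fun y => ?_
        rw [hneg]
        simp [hψe])
      (hV.pi n V (fun p => F (Fin.cons p.1 p.2) * ∏ i, ψ (p.2 i))
        (fun x => (hFc.comp (measurable_const.prodMk measurable_id)).mul (hpm hψm n))
        (hlcc.mul ((hψ.prod_pi Finset.univ).comp_linear (LinearMap.snd ℝ V (Fin n → V)))))
      (fun x => by
        calc _ ≤ ∫⁻ y : Fin n → V, ∏ i, ψ (y i) :=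
              lintegral_mono fun y => mul_le_of_le_one_left' (h1 _)
          _ ≤ 1 := by rw [lintegral_prod_pi n hψm]; exact pow_le_one' hψ1 n)
    have step2 := ih (fun y => ∫⁻ x, F (Fin.cons x y) * φ x)
      ((hFc.mul (hφm.comp measurable_fst)).lintegral_prod_left')
      (fun y => by
        rw [← lintegral_neg_eq_self]
        refine lintegral_congr fun x => ?_
        rw [hneg, hφe])
      (hV (Fin n → V) (fun p => F (Fin.cons p.2 p.1) * φ p.2)
        (fun y => (hFc.comp (measurable_id.prodMk measurable_const)).mul hφm)
        ((hlcc.comp_linear ((LinearMap.snd ℝ (Fin n → V) V).prod (LinearMap.fst ℝ (Fin n → V) V))).mul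
          (hφ.comp_linear (LinearMap.snd ℝ (Fin n → V) V))))
      (fun y => by
        calc _ ≤ ∫⁻ x, φ x :=
              lintegral_mono fun y => mul_le_of_le_one_left' (h1 _)
          _ ≤ 1 := hφ1)
    calc ∫⁻ x, F x * ∏ i, ψ (x i)
        = ∫⁻ x, (∫⁻ y : Fin n → V, F (Fin.cons x y) * ∏ i, ψ (y i)) * ψ x := by
          rw [lintegral_fin_succ (g := fun x => F x * ∏ i, ψ (x i)) (hF.mul (hpm hψm _))]
          refine lintegral_congr fun x => ?_
          rw [← lintegral_mul_const]
          · refine lintegral_congr fun y => ?_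
            simp only [Fin.prod_univ_succ, Fin.cons_zero, Fin.cons_succ]
            ring
          · exact (hFc.comp (measurable_const.prodMk measurable_id)).mul (hpm hψm n)
      _ ≤ ∫⁻ x, (∫⁻ y : Fin n → V, F (Fin.cons x y) * ∏ i, ψ (y i)) * φ x := step1
      _ = ∫⁻ x, ∫⁻ y : Fin n → V, F (Fin.cons x y) * φ x * ∏ i, ψ (y i) := by
          refine lintegral_congr fun x => ?_
          rw [← lintegral_mul_const]
          · refine lintegral_congr fun y => ?_
            ring
          · exact (hFc.comp (measurable_const.prodMk measurable_id)).mul (hpm hψm n)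
      _ = ∫⁻ y : Fin n → V, ∫⁻ x, F (Fin.cons x y) * φ x * ∏ i, ψ (y i) := by
          refine lintegral_lintegral_swap ?_
          exact ((hFc.mul (hφm.comp measurable_fst)).mul
            ((hpm hψm n).comp measurable_snd)).aemeasurable
      _ = ∫⁻ y : Fin n → V, (∫⁻ x, F (Fin.cons x y) * φ x) * ∏ i, ψ (y i) := by
          refine lintegral_congr fun y => ?_
          rw [lintegral_mul_const]
          exact (hFc.comp (measurable_id.prodMk measurable_const)).mul hφm
      _ ≤ ∫⁻ y : Fin n → V, (∫⁻ x, F (Fin.cons x y) * φ x) * ∏ i, φ (y i) := step2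
      _ = ∫⁻ y : Fin n → V, ∫⁻ x, F (Fin.cons x y) * φ x * ∏ i, φ (y i) := by
          refine lintegral_congr fun y => ?_
          rw [lintegral_mul_const]
          exact (hFc.comp (measurable_id.prodMk measurable_const)).mul hφm
      _ = ∫⁻ x, ∫⁻ y : Fin n → V, F (Fin.cons x y) * φ x * ∏ i, φ (y i) := by
          refine (lintegral_lintegral_swap ?_).symm
          exact ((hFc.mul (hφm.comp measurable_fst)).mul
            ((hpm hφm n).comp measurable_snd)).aemeasurable
      _ = ∫⁻ x, F x * ∏ i, φ (x i) := by
          rw [lintegral_fin_succ (g := fun x => F x * ∏ i, φ (x i)) (hF.mul (hpm hφm _))]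
          refine lintegral_congr fun x => lintegral_congr fun y => ?_
          simp only [Fin.prod_univ_succ, Fin.cons_zero, Fin.cons_succ]
          ring

end

theorem tendsto_measure_gauge_le {Ω : Type*} [MeasurableSpace Ω] {ν : Measure Ω} {M : Ω → ℝ}
    (hMm : Measurable M) {d : ℕ} {b : ℝ≥0∞} (hb : b ≠ ∞)
    (h : ∀ r : ℝ, 0 < r → ν {x | M x ≤ r} = ENNReal.ofReal r ^ d * b) :
    Tendsto (fun n : ℕ => ENNReal.ofReal (1 / ((n : ℝ) + 1)) ^ d * b) atTop
      (nhds (ν {x | M x ≤ 0})) := by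
  have hset : {x | M x ≤ 0} = ⋂ n : ℕ, {x | M x ≤ 1 / ((n : ℝ) + 1)} := by
    ext x
    simp only [Set.mem_ofPred_eq, Set.mem_iInter]
    refine ⟨fun hx n => hx.trans (by positivity), fun hx => ?_⟩
    exact ge_of_tendsto' tendsto_one_div_add_atTop_nhds_zero_nat hx
  rw [hset]
  simp_rw [fun n : ℕ => (h (1 / ((n : ℝ) + 1)) (by positivity)).symm]
  refine tendsto_measure_iInter_atTop (fun n => (measurableSet_le hMm measurable_const).nullMeasurableSet)
    (fun i j hij => fun x (hx : M x ≤ _) => show M x ≤ _ from hx.trans ?_) ⟨0, ?_⟩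
  · exact one_div_le_one_div_of_le (by positivity) (by gcongr)
  · rw [h _ (by positivity)]
    exact ENNReal.mul_ne_top (ENNReal.pow_ne_top ENNReal.ofReal_ne_top) hb

theorem lintegral_comp_gauge {Ω₁ Ω₂ : Type*} [MeasurableSpace Ω₁] [MeasurableSpace Ω₂]
    {ν₁ : Measure Ω₁} {ν₂ : Measure Ω₂} {M₁ : Ω₁ → ℝ} {M₂ : Ω₂ → ℝ}
    (h₁0 : ∀ x, 0 ≤ M₁ x) (h₂0 : ∀ x, 0 ≤ M₂ x) (h₁m : Measurable M₁) (h₂m : Measurable M₂)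
    {d : ℕ} {b₁ b₂ : ℝ≥0∞} (hb₁ : b₁ ≠ ∞) (hb₂ : b₂ ≠ ∞)
    (h₁ : ∀ r : ℝ, 0 < r → ν₁ {x | M₁ x ≤ r} = ENNReal.ofReal r ^ d * b₁)
    (h₂ : ∀ r : ℝ, 0 < r → ν₂ {x | M₂ x ≤ r} = ENNReal.ofReal r ^ d * b₂)
    {w : ℝ → ℝ≥0∞} (hw : Measurable w) :
    b₂ * ∫⁻ x, w (M₁ x) ∂ν₁ = b₁ * ∫⁻ x, w (M₂ x) ∂ν₂ := by
  have hIic : ∀ r : ℝ, b₂ * ν₁ {x | M₁ x ≤ r} = b₁ * ν₂ {x | M₂ x ≤ r} := by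
    intro r
    rcases lt_trichotomy r 0 with hr | rfl | hr
    · have e₁ : {x | M₁ x ≤ r} = ∅ := by
        ext x; simpa using hr.trans_le (h₁0 x)
      have e₂ : {x | M₂ x ≤ r} = ∅ := by
        ext x; simpa using hr.trans_le (h₂0 x)
      simp [e₁, e₂]
    · have t₁ := ENNReal.Tendsto.const_mul (a := b₂) (tendsto_measure_gauge_le h₁m hb₁ h₁)
        (Or.inr hb₂)
      have t₂ := ENNReal.Tendsto.const_mul (a := b₁) (tendsto_measure_gauge_le h₂m hb₂ h₂)
        (Or.inr hb₁)
      refine tendsto_nhds_unique t₁ ?_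
      convert t₂ using 2
      ring
    · rw [h₁ r hr, h₂ r hr]; ring
  have hfin : ∀ r : ℝ, b₂ * ν₁ {x | M₁ x ≤ r} ≠ ∞ := by
    intro r
    refine ne_top_of_le_ne_top ?_ (mul_le_mul_right (measure_mono
      (show {x | M₁ x ≤ r} ⊆ {x | M₁ x ≤ max r 1} from
        fun x (hx : M₁ x ≤ r) => show M₁ x ≤ max r 1 from hx.trans (le_max_left _ _))) _)
    rw [h₁ _ (by positivity)]
    exact ENNReal.mul_ne_top hb₂
      (ENNReal.mul_ne_top (ENNReal.pow_ne_top ENNReal.ofReal_ne_top) hb₁)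
  have ev₁ : ∀ r, (b₂ • ν₁.map M₁) (Set.Iic r) = b₂ * ν₁ {x | M₁ x ≤ r} := fun r => by
    rw [Measure.smul_apply, Measure.map_apply h₁m measurableSet_Iic]; rfl
  have ev₂ : ∀ r, (b₁ • ν₂.map M₂) (Set.Iic r) = b₁ * ν₂ {x | M₂ x ≤ r} := fun r => by
    rw [Measure.smul_apply, Measure.map_apply h₂m measurableSet_Iic]; rfl
  have hfin₁ : ∀ r, (b₂ • ν₁.map M₁) (Set.Iic r) ≠ ∞ := fun r => by rw [ev₁]; exact hfin r
  have hfin₂ : ∀ r, (b₁ • ν₂.map M₂) (Set.Iic r) ≠ ∞ := fun r => by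
    rw [ev₂, ← hIic]; exact hfin r
  have hdiff : ∀ a b : ℝ, Set.Ioc a b = Set.Iic b \ Set.Iic a := fun a b => by
    ext x; simp [and_comm]
  have hmeas : b₂ • ν₁.map M₁ = b₁ • ν₂.map M₂ := by
    refine Measure.ext_of_Ioc' _ _ (fun a b _ => ?_) fun a b hab => ?_
    · exact ne_top_of_le_ne_top (hfin₁ b) (measure_mono Set.Ioc_subset_Iic_self)
    · rw [hdiff a b, measure_sdiff (Set.Iic_subset_Iic.2 hab.le)
        measurableSet_Iic.nullMeasurableSet (hfin₁ a), measure_sdiff (Set.Iic_subset_Iic.2 hab.le)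
        measurableSet_Iic.nullMeasurableSet (hfin₂ a), ev₁, ev₁, ev₂, ev₂, hIic, hIic]
  rw [← lintegral_map hw h₁m, ← lintegral_map hw h₂m, ← smul_eq_mul, ← smul_eq_mul,
    ← lintegral_smul_measure, ← lintegral_smul_measure, hmeas]

section

variable {V : Type} [NormedAddCommGroup V] [NormedSpace ℝ V] [FiniteDimensional ℝ V]
  [MeasureSpace V] [BorelSpace V] [(volume : Measure V).IsAddHaarMeasure]

theorem lintegral_comp_inv_smul (g : V → ℝ≥0∞) {r : ℝ} (hr : 0 < r) :
    ∫⁻ x, g (r⁻¹ • x) = ENNReal.ofReal r ^ Module.finrank ℝ V * ∫⁻ x, g x := by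
  have he : MeasurableEmbedding fun x : V => r⁻¹ • x :=
    (Homeomorph.smulOfNeZero r⁻¹ (inv_pos.2 hr).ne').measurableEmbedding
  rw [← he.lintegral_map, Measure.map_addHaar_smul _ (inv_pos.2 hr).ne', lintegral_smul_measure,
    inv_pow, inv_inv, abs_of_pos (by positivity), ENNReal.ofReal_pow hr.le, smul_eq_mul]

theorem withDensity_gauge_le {N : V → ℝ} (hNm : Measurable N)
    (hN : ∀ (s : ℝ) (x : V), N (s • x) = |s| * N x) {C : V → ℝ≥0∞}
    (hC : ∀ (s : ℝ) (x : V), 0 < s → C (s • x) = C x) {r : ℝ} (hr : 0 < r) :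
    (volume.withDensity C) {x | N x ≤ r} = ENNReal.ofReal r ^ Module.finrank ℝ V *
      (volume.withDensity C) {x | N x ≤ 1} := by
  have hms : ∀ r : ℝ, MeasurableSet {x | N x ≤ r} := fun r => measurableSet_le hNm measurable_const
  rw [withDensity_apply _ (hms r), withDensity_apply _ (hms 1), ← lintegral_indicator (hms r),
    ← lintegral_indicator (hms 1), ← lintegral_comp_inv_smul _ hr]
  refine lintegral_congr fun x => ?_
  have : N (r⁻¹ • x) ≤ 1 ↔ N x ≤ r := by
    rw [hN, abs_of_pos (inv_pos.2 hr), inv_mul_le_one₀ hr]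
  simp only [Set.indicator, Set.mem_ofPred_eq, this, hC _ _ (inv_pos.2 hr)]

theorem volume_gauge_le {N : V → ℝ} (hNm : Measurable N)
    (hN : ∀ (s : ℝ) (x : V), N (s • x) = |s| * N x) {r : ℝ} (hr : 0 < r) :
    volume {x | N x ≤ r} = ENNReal.ofReal r ^ Module.finrank ℝ V * volume {x | N x ≤ 1} := by
  have := withDensity_gauge_le hNm hN (C := 1) (fun _ _ _ => rfl) hr
  rwa [withDensity_one] at this

/-- A radial density crossing another one of the same mass once, from above, is more peaked. -/
theorem peaked_of_crossing {N : V → ℝ} (hNm : Measurable N) (hN0 : ∀ x, 0 ≤ N x)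
    (hN : ∀ (s : ℝ) (x : V), N (s • x) = |s| * N x) (hNd : ∀ x, N x = 0 → x = 0)
    (hfin : volume {x | N x ≤ 1} ≠ ∞) (hpos : volume {x | N x ≤ 1} ≠ 0)
    {w₁ w₂ : ℝ → ℝ≥0∞} (hw₁ : Measurable w₁) (hw₂ : Measurable w₂)
    (h_int : ∫⁻ x, w₁ (N x) = ∫⁻ x, w₂ (N x)) (hintfin : ∫⁻ x, w₁ (N x) ≠ ∞)
    {t₀ : ℝ} (ht₀ : 0 ≤ t₀) (hlo : ∀ t, 0 < t → t < t₀ → w₂ t ≤ w₁ t)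
    (hhi : ∀ t, t₀ < t → w₁ t ≤ w₂ t) :
    Peaked (fun x => w₁ (N x)) (fun x => w₂ (N x)) := by
  intro F hF he hlc h1
  set C : V → ℝ≥0∞ := fun x => F ((t₀ / N x) • x) with hC
  have hCm : Measurable C := hF.comp ((measurable_const.div hNm).smul measurable_id)
  have hC1 : ∀ x, C x ≤ 1 := fun x => h1 _
  have hChom : ∀ (s : ℝ) (x : V), 0 < s → C (s • x) = C x := by
    intro s x hs
    simp only [hC]
    rw [hN, abs_of_pos hs, smul_smul]
    congr 2
    rw [div_mul_eq_mul_div, mul_comm s (N x), mul_div_mul_right _ _ hs.ne']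
  have hκfin : (volume.withDensity C) {x | N x ≤ 1} ≠ ∞ := by
    refine ne_top_of_le_ne_top hfin ?_
    rw [withDensity_apply _ (measurableSet_le hNm measurable_const)]
    refine (lintegral_mono fun x => hC1 x).trans ?_
    simp
  have hCw : ∀ {w : ℝ → ℝ≥0∞}, Measurable w → volume {x | N x ≤ 1} * ∫⁻ x, C x * w (N x) =
      (volume.withDensity C) {x | N x ≤ 1} * ∫⁻ x, w (N x) := by
    intro w hw
    rw [← lintegral_comp_gauge hN0 hN0 hNm hNm hκfin hfin
      (fun r hr => withDensity_gauge_le hNm hN hChom hr) (fun r hr => volume_gauge_le hNm hN hr) hw,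
      lintegral_withDensity_eq_lintegral_mul _ hCm (g := fun x => w (N x)) (hw.comp hNm)]
    rfl
  have hCeq : ∫⁻ x, C x * w₁ (N x) = ∫⁻ x, C x * w₂ (N x) := by
    have := (hCw hw₁).trans ((congrArg _ h_int).trans (hCw hw₂).symm)
    exact (ENNReal.mul_right_inj hpos hfin).1 this
  have hCfin : ∫⁻ x, C x * w₁ (N x) ≠ ∞ :=
    ne_top_of_le_ne_top hintfin (lintegral_mono fun x => mul_le_of_le_one_left' (hC1 x))
  have hpt : ∀ x, F x * w₂ (N x) + C x * w₁ (N x) ≤ F x * w₁ (N x) + C x * w₂ (N x) := by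
    intro x
    have aux : ∀ a b c d : ℝ≥0∞, a ≤ b → c ≤ d → b * c + a * d ≤ b * d + a * c := by
      intro a b c d hab hcd
      obtain ⟨e, rfl⟩ := exists_add_of_le hab
      obtain ⟨f, rfl⟩ := exists_add_of_le hcd
      calc (a + e) * c + a * (c + f) ≤ (a + e) * c + a * (c + f) + e * f := le_self_add
        _ = _ := by ring
    rcases eq_or_ne x 0 with rfl | hx
    · have : C 0 = F 0 := by simp [hC]
      rw [this, add_comm]
    have hNx : 0 < N x := lt_of_le_of_ne (hN0 x) fun h => hx (hNd x h.symm)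
    rcases lt_trichotomy (N x) t₀ with h | h | h
    · refine aux _ _ _ _ ?_ (hlo _ hNx h)
      have := hlc.le_smul he ((t₀ / N x) • x) (s := N x / t₀) (by positivity)
        ((div_le_one (hNx.trans h)).2 h.le)
      rwa [smul_smul, div_mul_div_cancel₀ (hNx.trans h).ne', div_self hNx.ne', one_smul] at this
    · have : C x = F x := by simp [hC, ← h, div_self hNx.ne']
      rw [this, add_comm]
    · have := aux _ _ _ _ (hlc.le_smul he x (s := t₀ / N x) (by positivity)
        ((div_le_one hNx).2 h.le)) (hhi _ h)
      rw [add_comm, add_comm (F x * w₁ (N x))]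
      exact this
  have hmain := lintegral_mono (μ := (volume : Measure V)) hpt
  rw [lintegral_add_left (f := fun x => F x * w₂ (N x)) (hF.mul (hw₂.comp hNm)),
    lintegral_add_left (f := fun x => F x * w₁ (N x)) (hF.mul (hw₁.comp hNm)),
    ← hCeq] at hmain
  exact (ENNReal.add_le_add_iff_right hCfin).1 hmain

end

/-- The profile `t ↦ exp (-|t|^p)`, read as the indicator of `[-1, 1]` when `p = ∞`. -/
def expProfile (p : ℝ≥0∞) (t : ℝ) : ℝ≥0∞ :=
  if p = ⊤ then (if |t| ≤ 1 then 1 else 0) else ENNReal.ofReal (exp (-|t| ^ p.toReal))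

theorem expProfile_top (t : ℝ) : expProfile ⊤ t = if |t| ≤ 1 then 1 else 0 := by
  simp [expProfile]

theorem expProfile_of_ne_top {p : ℝ≥0∞} (hp : p ≠ ⊤) (t : ℝ) :
    expProfile p t = ENNReal.ofReal (exp (-|t| ^ p.toReal)) := by
  simp [expProfile, hp]

theorem one_le_toReal {p : ℝ≥0∞} (hp : 1 ≤ p) (hp' : p ≠ ⊤) : 1 ≤ p.toReal := by
  simpa using ENNReal.toReal_mono hp' hp

theorem two_le_toReal {p : ℝ≥0∞} (hp : 2 ≤ p) (hp' : p ≠ ⊤) : 2 ≤ p.toReal := by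
  simpa using ENNReal.toReal_mono hp' hp

theorem measurable_expProfile (p : ℝ≥0∞) : Measurable (expProfile p) := by
  by_cases hp : p = ⊤
  · subst hp
    simp only [funext expProfile_top]
    exact Measurable.ite (measurableSet_le measurable_abs measurable_const)
      measurable_const measurable_const
  · simp only [funext (expProfile_of_ne_top hp)]
    exact ((measurable_abs.pow_const _).neg.exp).ennreal_ofReal

theorem expProfile_abs (p : ℝ≥0∞) (t : ℝ) : expProfile p |t| = expProfile p t := by
  simp [expProfile]

theorem expProfile_anti (p : ℝ≥0∞) {s t : ℝ} (h : |s| ≤ |t|) :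
    expProfile p t ≤ expProfile p s := by
  by_cases hp : p = ⊤
  · subst hp
    rw [expProfile_top, expProfile_top]
    split_ifs with h1 h2 <;> first | (simp; done) | exact absurd (h.trans h1) h2
  · rw [expProfile_of_ne_top hp, expProfile_of_ne_top hp]
    gcongr

theorem logConc_expProfile {p : ℝ≥0∞} (hp : 1 ≤ p) : LogConc (expProfile p) := by
  intro x y a b ha hb hab
  have habs : |a * x + b * y| ≤ a * |x| + b * |y| := by
    refine (abs_add_le _ _).trans_eq ?_
    rw [abs_mul, abs_mul, abs_of_pos ha, abs_of_pos hb]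
  by_cases hp' : p = ⊤
  · subst hp'
    simp only [expProfile_top, smul_eq_mul]
    split_ifs with h1 h2 h3 h3 h3 h3 <;>
      first
      | simp [ENNReal.zero_rpow_of_pos ha, ENNReal.zero_rpow_of_pos hb]; done
      | exact absurd (habs.trans (by nlinarith)) h3
  · simp only [expProfile_of_ne_top hp', smul_eq_mul]
    rw [ENNReal.ofReal_rpow_of_nonneg (exp_pos _).le ha.le,
      ENNReal.ofReal_rpow_of_nonneg (exp_pos _).le hb.le, ← ENNReal.ofReal_mul (by positivity),
      ← Real.exp_mul, ← Real.exp_mul, ← Real.exp_add]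
    apply ENNReal.ofReal_le_ofReal
    apply Real.exp_le_exp.2
    have h1 : |a * x + b * y| ^ p.toReal ≤ (a * |x| + b * |y|) ^ p.toReal :=
      Real.rpow_le_rpow (abs_nonneg _) habs (by positivity)
    have h2 := (convexOn_rpow (one_le_toReal hp hp')).2 (abs_nonneg x) (abs_nonneg y) ha.le hb.le hab
    simp only [smul_eq_mul] at h2
    linarith

theorem LogConc.expProfile_comp {p : ℝ≥0∞} (hp : 1 ≤ p) {V : Type*} [AddCommGroup V] [Module ℝ V]
    {N : V → ℝ} (hN0 : ∀ x, 0 ≤ N x) (hadd : ∀ x y, N (x + y) ≤ N x + N y)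
    (hN : ∀ (s : ℝ) (x : V), N (s • x) = |s| * N x) {c : ℝ} (hc : 0 ≤ c) :
    LogConc fun x => expProfile p (c * N x) := by
  intro x y a b ha hb hab
  refine (logConc_expProfile hp (c * N x) (c * N y) a b ha hb hab).trans (expProfile_anti p ?_)
  have := hadd (a • x) (b • y)
  rw [hN, hN, abs_of_pos ha, abs_of_pos hb] at this
  simp only [smul_eq_mul]
  rw [abs_of_nonneg (mul_nonneg hc (hN0 _)), abs_of_nonneg (by
    have := hN0 x; have := hN0 y; positivity)]
  nlinarith

theorem lqNormE_eq_norm {m : ℕ} {q : ℝ≥0∞} (hq : 1 ≤ q) (x : Fin m → ℝ) :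
    lqNormE m q x = ‖WithLp.toLp q x‖ := by
  unfold lqNormE
  split_ifs with h
  · subst h
    simp [PiLp.norm_eq_ciSup]
  · have : 0 < q.toReal := zero_lt_one.trans_le (one_le_toReal hq h)
    simp [PiLp.norm_eq_sum this]

section

variable {m : ℕ} {q : ℝ≥0∞} (hq : 1 ≤ q)
include hq

theorem lqNormE_nonneg (x : Fin m → ℝ) : 0 ≤ lqNormE m q x := by
  have : Fact (1 ≤ q) := ⟨hq⟩
  rw [lqNormE_eq_norm hq]; exact norm_nonneg _

theorem lqNormE_smul (s : ℝ) (x : Fin m → ℝ) : lqNormE m q (s • x) = |s| * lqNormE m q x := by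
  have : Fact (1 ≤ q) := ⟨hq⟩
  rw [lqNormE_eq_norm hq, lqNormE_eq_norm hq, WithLp.toLp_smul, norm_smul, Real.norm_eq_abs]

theorem lqNormE_add_le (x y : Fin m → ℝ) :
    lqNormE m q (x + y) ≤ lqNormE m q x + lqNormE m q y := by
  have : Fact (1 ≤ q) := ⟨hq⟩
  simp only [lqNormE_eq_norm hq, WithLp.toLp_add]
  exact norm_add_le _ _

theorem eq_zero_of_lqNormE_eq_zero (x : Fin m → ℝ) (h : lqNormE m q x = 0) : x = 0 := by
  have : Fact (1 ≤ q) := ⟨hq⟩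
  rw [lqNormE_eq_norm hq, norm_eq_zero] at h
  simpa using h

theorem continuous_lqNormE : Continuous (lqNormE m q) := by
  have : Fact (1 ≤ q) := ⟨hq⟩
  rw [funext (lqNormE_eq_norm hq)]
  exact continuous_norm.comp (PiLp.continuous_toLp q _)

theorem abs_le_lqNormE (x : Fin m → ℝ) (j : Fin m) : |x j| ≤ lqNormE m q x := by
  have : Fact (1 ≤ q) := ⟨hq⟩
  rw [lqNormE_eq_norm hq]
  exact PiLp.norm_apply_le (WithLp.toLp q x) j

theorem volume_lqNormE_le_ne_top : volume {x | lqNormE m q x ≤ 1} ≠ ∞ := by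
  refine ne_top_of_le_ne_top (measure_closedBall_lt_top (x := (0 : Fin m → ℝ)) (r := 1)).ne
    (measure_mono fun x (hx : lqNormE m q x ≤ 1) => ?_)
  rw [mem_closedBall_zero_iff, pi_norm_le_iff_of_nonneg zero_le_one]
  exact fun j => (abs_le_lqNormE hq x j).trans hx

theorem volume_lqNormE_le_ne_zero : volume {x | lqNormE m q x ≤ 1} ≠ 0 := by
  have h0 : lqNormE m q 0 = 0 := by simpa using lqNormE_smul hq 0 (0 : Fin m → ℝ)
  have ho : IsOpen {x | lqNormE m q x < 1} :=
    isOpen_lt (continuous_lqNormE hq) continuous_const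
  have hpos := ho.measure_pos volume ⟨0, by simp [h0]⟩
  exact (hpos.trans_le (measure_mono
    (show {x | lqNormE m q x < 1} ⊆ {x | lqNormE m q x ≤ 1} from
      fun x (hx : lqNormE m q x < 1) => show lqNormE m q x ≤ 1 from hx.le))).ne'

theorem prod_expProfile (x : Fin m → ℝ) : ∏ j, expProfile q (x j) = expProfile q (lqNormE m q x) := by
  by_cases h : q = ⊤
  · subst h
    have hiff : |lqNormE m ⊤ x| ≤ 1 ↔ ∀ j, |x j| ≤ 1 := by
      rw [abs_of_nonneg (lqNormE_nonneg hq x)]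
      refine ⟨fun hx j => (abs_le_lqNormE hq x j).trans hx, fun hx => ?_⟩
      simpa [lqNormE] using Real.iSup_le hx zero_le_one
    simp only [expProfile_top, hiff]
    by_cases hall : ∀ j, |x j| ≤ 1
    · simp [hall]
    · rw [if_neg hall]
      push Not at hall
      obtain ⟨j, hj⟩ := hall
      exact Finset.prod_eq_zero (Finset.mem_univ j) (by simp [hj])
  · have hpos : 0 < q.toReal := zero_lt_one.trans_le (one_le_toReal hq h)
    have hs : 0 ≤ ∑ j, |x j| ^ q.toReal := by positivity
    simp only [expProfile_of_ne_top h]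
    rw [← ENNReal.ofReal_prod_of_nonneg fun _ _ => (exp_pos _).le, ← Real.exp_sum,
      abs_of_nonneg (lqNormE_nonneg hq x)]
    simp only [lqNormE, if_neg h]
    rw [← Real.rpow_mul hs, one_div_mul_cancel hpos.ne', Real.rpow_one, Finset.sum_neg_distrib]

theorem prod_expProfile_mul (c : ℝ) (x : Fin m → ℝ) :
    ∏ j, expProfile q (c * x j) = expProfile q (c * lqNormE m q x) := by
  have := prod_expProfile hq (c • x)
  simp only [Pi.smul_apply, smul_eq_mul] at this
  rw [this, lqNormE_smul hq, ← expProfile_abs q (c * _), abs_mul,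
    abs_of_nonneg (lqNormE_nonneg hq x)]

end

theorem expProfile_le_gaussian {p : ℝ≥0∞} (hp : 2 ≤ p) (t : ℝ) :
    expProfile p t ≤ ENNReal.ofReal (exp 1) * ENNReal.ofReal (exp (-t ^ 2)) := by
  rw [← ENNReal.ofReal_mul (exp_pos _).le, ← Real.exp_add]
  by_cases h : p = ⊤
  · subst h
    rw [expProfile_top]
    split_ifs with ht
    · rw [ENNReal.one_le_ofReal, Real.one_le_exp_iff]
      have := (sq_le_one_iff_abs_le_one t).2 ht
      linarith
    · simp
  · rw [expProfile_of_ne_top h]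
    apply ENNReal.ofReal_le_ofReal
    apply Real.exp_le_exp.2
    have h2 := two_le_toReal hp h
    rcases le_total |t| 1 with ht | ht
    · have := (sq_le_one_iff_abs_le_one t).2 ht
      have : 0 ≤ |t| ^ p.toReal := by positivity
      linarith
    · have : |t| ^ (2 : ℝ) ≤ |t| ^ p.toReal := Real.rpow_le_rpow_of_exponent_le ht h2
      rw [Real.rpow_two, sq_abs] at this
      linarith

theorem le_expProfile {p : ℝ≥0∞} {t : ℝ} (ht : |t| ≤ 1) :
    ENNReal.ofReal (exp (-1)) ≤ expProfile p t := by
  by_cases h : p = ⊤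
  · subst h
    rw [expProfile_top, if_pos ht]
    simp
  · rw [expProfile_of_ne_top h]
    apply ENNReal.ofReal_le_ofReal
    apply Real.exp_le_exp.2
    have := Real.rpow_le_one (abs_nonneg t) ht (z := p.toReal) ENNReal.toReal_nonneg
    linarith

theorem lintegral_gaussian_ne_top {c : ℝ} (hc : 0 < c) :
    ∫⁻ t : ℝ, ENNReal.ofReal (exp (-c * t ^ 2)) ≠ ∞ :=
  (integrable_exp_neg_mul_sq hc).lintegral_lt_top.ne

theorem lintegral_expProfile_lqNormE_ne_top {m : ℕ} {p q : ℝ≥0∞} (hp : 2 ≤ p) (hq : 1 ≤ q) :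
    ∫⁻ x, expProfile p (lqNormE m q x) ≠ ∞ := by
  have hc : (0 : ℝ) < 1 / ((m : ℝ) + 1) := by positivity
  have hb : ∀ x : Fin m → ℝ, expProfile p (lqNormE m q x) ≤ ENNReal.ofReal (exp 1) *
      ∏ j, ENNReal.ofReal (exp (-(1 / ((m : ℝ) + 1)) * x j ^ 2)) := by
    intro x
    refine (expProfile_le_gaussian hp _).trans (mul_le_mul_right ?_ _)
    rw [← ENNReal.ofReal_prod_of_nonneg fun _ _ => (exp_pos _).le, ← Real.exp_sum]
    apply ENNReal.ofReal_le_ofReal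
    apply Real.exp_le_exp.2
    rw [← Finset.mul_sum, neg_mul, neg_le_neg_iff, one_div_mul_eq_div, div_le_iff₀ (by positivity)]
    calc ∑ j, x j ^ 2 ≤ ∑ _j : Fin m, lqNormE m q x ^ 2 :=
          Finset.sum_le_sum fun j _ => sq_le_sq' (abs_le.1 (abs_le_lqNormE hq x j)).1
            (abs_le.1 (abs_le_lqNormE hq x j)).2
      _ ≤ _ := by simp; nlinarith [sq_nonneg (lqNormE m q x)]
  refine ne_top_of_le_ne_top ?_ (lintegral_mono hb)
  have hm : Measurable fun t : ℝ => ENNReal.ofReal (exp (-(1 / ((m : ℝ) + 1)) * t ^ 2)) := by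
    fun_prop
  rw [lintegral_const_mul' _ _ ENNReal.ofReal_ne_top, lintegral_prod_pi m hm]
  exact ENNReal.mul_ne_top ENNReal.ofReal_ne_top
    (ENNReal.pow_ne_top (lintegral_gaussian_ne_top hc))

theorem lintegral_expProfile_abs_ne_top {p : ℝ≥0∞} (hp : 2 ≤ p) :
    ∫⁻ t : ℝ, expProfile p |t| ≠ ∞ := by
  refine ne_top_of_le_ne_top ?_ (lintegral_mono fun t => expProfile_le_gaussian hp |t|)
  rw [lintegral_const_mul' _ _ ENNReal.ofReal_ne_top]
  have := lintegral_gaussian_ne_top zero_lt_one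
  simp only [sq_abs, neg_mul, one_mul] at this ⊢
  exact ENNReal.mul_ne_top ENNReal.ofReal_ne_top this

section

variable {V : Type} [NormedAddCommGroup V] [NormedSpace ℝ V] [FiniteDimensional ℝ V]
  [MeasureSpace V] [BorelSpace V] [(volume : Measure V).IsAddHaarMeasure]

theorem exists_lintegral_expProfile_eq_one [Nontrivial V] {N : V → ℝ} (hNm : Measurable N)
    (hN0 : ∀ x, 0 ≤ N x) (hN : ∀ (s : ℝ) (x : V), N (s • x) = |s| * N x)
    (hpos : volume {x | N x ≤ 1} ≠ 0) {p : ℝ≥0∞} (hfin : ∫⁻ x, expProfile p (N x) ≠ ∞) :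
    ∃ α : ℝ, 0 < α ∧ ∫⁻ x, expProfile p (α * N x) = 1 := by
  have hI : ∫⁻ x, expProfile p (N x) ≠ 0 := by
    have : ENNReal.ofReal (exp (-1)) * volume {x | N x ≤ 1} ≤ ∫⁻ x, expProfile p (N x) := by
      rw [← setLIntegral_const]
      refine (setLIntegral_mono' (measurableSet_le hNm measurable_const) fun x hx => ?_).trans
        (setLIntegral_le_lintegral _ _)
      exact le_expProfile (by rwa [abs_of_nonneg (hN0 x)])
    have h0 : ENNReal.ofReal (exp (-1)) * volume {x | N x ≤ 1} ≠ 0 :=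
      mul_ne_zero (by simpa using exp_pos _) hpos
    exact fun h => h0 (le_antisymm (h ▸ this) zero_le)
  set I := (∫⁻ x, expProfile p (N x)).toReal with hIdef
  have hIpos : 0 < I := ENNReal.toReal_pos hI hfin
  set d := Module.finrank ℝ V
  have hd : (d : ℝ) ≠ 0 := by exact_mod_cast (Module.finrank_pos (R := ℝ) (M := V)).ne'
  refine ⟨I ^ (1 / (d : ℝ)), by positivity, ?_⟩
  set r := (I ^ (1 / (d : ℝ)))⁻¹ with hr
  have hrpos : 0 < r := by positivity
  have h := lintegral_comp_inv_smul (fun x => expProfile p (N x)) hrpos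
  simp only [hN, abs_of_pos (inv_pos.2 hrpos)] at h
  rw [hr, inv_inv] at h
  rw [h, ← ENNReal.ofReal_toReal hfin, ← hIdef, ← ENNReal.ofReal_pow (by positivity),
    ← ENNReal.ofReal_mul (by positivity), inv_pow, ← Real.rpow_natCast, ← Real.rpow_mul hIpos.le,
    one_div_mul_cancel hd, Real.rpow_one, inv_mul_cancel₀ hIpos.ne', ENNReal.ofReal_one]

theorem peaked_expProfile {N : V → ℝ} (hNm : Measurable N) (hN0 : ∀ x, 0 ≤ N x)
    (hN : ∀ (s : ℝ) (x : V), N (s • x) = |s| * N x) (hNd : ∀ x, N x = 0 → x = 0)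
    (hfin : volume {x | N x ≤ 1} ≠ ∞) (hpos : volume {x | N x ≤ 1} ≠ 0) {p q : ℝ≥0∞}
    (hqp : q ≤ p) {α β : ℝ} (hα : 0 < α) (hβ : 0 < β)
    (h₁ : ∫⁻ x, expProfile p (α * N x) = 1) (h₂ : ∫⁻ x, expProfile q (β * N x) = 1) :
    Peaked (fun x => expProfile p (α * N x)) (fun x => expProfile q (β * N x)) := by
  have key : ∀ t₀ : ℝ, 0 ≤ t₀ →
      (∀ t, 0 < t → t < t₀ → expProfile q (β * t) ≤ expProfile p (α * t)) →
      (∀ t, t₀ < t → expProfile p (α * t) ≤ expProfile q (β * t)) →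
      Peaked (fun x => expProfile p (α * N x)) (fun x => expProfile q (β * N x)) :=
    fun t₀ ht₀ hlo hhi => peaked_of_crossing (w₁ := fun t => expProfile p (α * t))
      (w₂ := fun t => expProfile q (β * t)) hNm hN0 hN hNd hfin hpos
      ((measurable_expProfile p).comp (measurable_const_mul α))
      ((measurable_expProfile q).comp (measurable_const_mul β)) (h₁.trans h₂.symm)
      (by simp [h₁]) ht₀ hlo hhi
  rcases hqp.eq_or_lt with rfl | hlt
  · rcases le_total α β with hαβ | hαβ
    · intro F _ _ _ _
      refine lintegral_mono fun x => mul_le_mul_right (expProfile_anti q ?_) _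
      have := hN0 x
      rw [abs_of_nonneg (by positivity), abs_of_nonneg (by positivity)]
      gcongr
    · refine key 0 le_rfl (fun t h h' => absurd h' h.not_gt) fun t ht => expProfile_anti q ?_
      rw [abs_of_nonneg (by positivity), abs_of_nonneg (by positivity)]
      gcongr
  have hq' : q ≠ ⊤ := (hlt.trans_le le_top).ne
  by_cases hp : p = ⊤
  · subst hp
    refine key (1 / α) (by positivity) (fun t h0 ht => ?_) fun t ht => ?_
    · rw [expProfile_top, if_pos, expProfile_of_ne_top hq']
      · simp only [ENNReal.ofReal_le_one, Real.exp_le_one_iff, Left.neg_nonpos_iff]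
        positivity
      · rw [abs_of_pos (by positivity), mul_comm]
        exact ((lt_div_iff₀ hα).1 ht).le
    · rw [expProfile_top, if_neg]
      · exact zero_le
      · have : 0 < t := lt_trans (by positivity) ht
        rw [abs_of_pos (by positivity), mul_comm, not_le]
        exact (div_lt_iff₀ hα).1 ht
  · have hr : 0 < p.toReal - q.toReal := sub_pos.2 ((ENNReal.toReal_lt_toReal hq' hp).2 hlt)
    set r := p.toReal - q.toReal with hrdef
    set c := β ^ q.toReal / α ^ p.toReal with hcdef
    have hc : 0 < c := by positivity
    have hpow : ∀ t, 0 < t → (α * t) ^ p.toReal = (β * t) ^ q.toReal * (t ^ r / c) := by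
      intro t ht
      rw [Real.mul_rpow hα.le ht.le, Real.mul_rpow hβ.le ht.le, hcdef, hrdef, Real.rpow_sub ht]
      have : t ^ q.toReal ≠ 0 := by positivity
      have : β ^ q.toReal ≠ 0 := by positivity
      field_simp
    have hroot : (c ^ (1 / r)) ^ r = c := by
      rw [← Real.rpow_mul hc.le, one_div_mul_cancel hr.ne', Real.rpow_one]
    refine key (c ^ (1 / r)) (by positivity) (fun t h0 ht => ?_) fun t ht => ?_
    · rw [expProfile_of_ne_top hq', expProfile_of_ne_top hp]
      apply ENNReal.ofReal_le_ofReal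
      apply Real.exp_le_exp.2
      rw [neg_le_neg_iff, abs_of_pos (by positivity), abs_of_pos (by positivity), hpow t h0]
      refine mul_le_of_le_one_right (by positivity) ((div_le_one hc).2 ?_)
      rw [← hroot]
      exact Real.rpow_le_rpow h0.le ht.le hr.le
    · have h0 : 0 < t := lt_trans (by positivity) ht
      rw [expProfile_of_ne_top hq', expProfile_of_ne_top hp]
      apply ENNReal.ofReal_le_ofReal
      apply Real.exp_le_exp.2
      rw [neg_le_neg_iff, abs_of_pos (by positivity), abs_of_pos (by positivity), hpow t h0]
      refine le_mul_of_one_le_right (by positivity) ((one_le_div hc).2 ?_)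
      rw [← hroot]
      exact Real.rpow_le_rpow (by positivity) ht.le hr.le

end

/-- The standard Gaussian density `x ↦ exp (-π ∑ x_c ^ 2)` on `ℝ^κ`. -/
def gaussDensity {κ : Type*} [Fintype κ] (x : κ → ℝ) : ℝ≥0∞ :=
  ENNReal.ofReal (exp (-π * ∑ c, x c ^ 2))

theorem measurable_gaussDensity {κ : Type*} [Fintype κ] :
    Measurable (gaussDensity : (κ → ℝ) → ℝ≥0∞) := by
  unfold gaussDensity
  fun_prop

theorem lintegral_gaussDensity {κ : Type*} [Fintype κ] : ∫⁻ x : κ → ℝ, gaussDensity x = 1 := by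
  have hprod : ∀ x : κ → ℝ, exp (-π * ∑ c, x c ^ 2) = ∏ c, exp (-π * x c ^ 2) := fun x => by
    rw [Finset.mul_sum, Real.exp_sum]
  unfold gaussDensity
  simp only [hprod]
  have h_int : Integrable fun x : κ → ℝ => ∏ c, exp (-π * x c ^ 2) :=
    Integrable.fintype_prod (f := fun _ t => exp (-π * t ^ 2)) fun _ =>
      integrable_exp_neg_mul_sq pi_pos
  rw [← ofReal_integral_eq_lintegral_ofReal h_int
      (Eventually.of_forall fun x => Finset.prod_nonneg fun _ _ => (exp_pos _).le),
    integral_fintype_prod_volume_eq_prod fun _ t => exp (-π * t ^ 2)]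
  have h1 : ∫ t : ℝ, exp (-π * t ^ 2) = 1 := by
    rw [integral_gaussian, div_self pi_pos.ne', Real.sqrt_one]
  simp only [h1, Finset.prod_const_one, ENNReal.ofReal_one]

theorem measurePreserving_of_lintegral_eq_one {V W : Type*} [NormedAddCommGroup V] [NormedSpace ℝ V]
    [FiniteDimensional ℝ V] [MeasureSpace V] [BorelSpace V] [(volume : Measure V).IsAddHaarMeasure]
    [NormedAddCommGroup W] [NormedSpace ℝ W] [FiniteDimensional ℝ W] [MeasureSpace W] [BorelSpace W]
    [(volume : Measure W).IsAddHaarMeasure] (T : V ≃ₗ[ℝ] W) {g : W → ℝ≥0∞} (hg : Measurable g)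
    (h : ∫⁻ x, g (T x) = 1) (h' : ∫⁻ x, g x = 1) : MeasurePreserving T := by
  have hT : Continuous T := T.toLinearMap.continuous_of_finiteDimensional
  have hT' : Continuous T.symm := T.symm.toLinearMap.continuous_of_finiteDimensional
  have hH : (Measure.map T volume).IsAddHaarMeasure :=
    AddEquiv.isAddHaarMeasure_map volume T.toAddEquiv hT hT'
  have hc := Measure.isAddLeftInvariant_eq_smul (Measure.map T volume) (volume : Measure W)
  refine ⟨hT.measurable, ?_⟩
  rw [← lintegral_map hg hT.measurable, hc, lintegral_smul_measure, h', ENNReal.smul_def,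
    smul_eq_mul, mul_one, ENNReal.coe_eq_one] at h
  exact hc.trans (by rw [h, one_smul])

theorem measurePreserving_curry (k m : ℕ) :
    MeasurePreserving fun (x : Fin k × Fin m → ℝ) (i : Fin k) (j : Fin m) => x (i, j) := by
  refine measurePreserving_of_lintegral_eq_one (LinearEquiv.curry ℝ ℝ (Fin k) (Fin m))
    (g := fun x => ∏ i, gaussDensity (x i))
    (Finset.measurable_prod _ fun i _ => measurable_gaussDensity.comp (measurable_pi_apply i)) ?_ ?_
  · convert lintegral_gaussDensity (κ := Fin k × Fin m) using 3 with x
    simp only [gaussDensity]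
    rw [← ENNReal.ofReal_prod_of_nonneg fun _ _ => (exp_pos _).le, ← Real.exp_sum,
      Fintype.sum_prod_type, Finset.mul_sum]
    rfl
  · rw [lintegral_prod_pi k measurable_gaussDensity, lintegral_gaussDensity, one_pow]

section

variable {m n d : ℕ} {θ : Fin n → ℝ} (hθ : ∑ i, θ i ^ 2 = 1)
  {ι : (Fin d → ℝ) →ₗ[ℝ] (Fin n × Fin m → ℝ)} (hι : ∀ y, ∑ c, ι y c ^ 2 = ∑ i, y i ^ 2)
  (hιθ : ∀ y j, ∑ i, θ i * ι y (i, j) = 0)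
include hθ hι hιθ

theorem sum_sq_add_smul (y : Fin d → ℝ) (s : Fin m → ℝ) :
    ∑ i, ∑ j, (ι y (i, j) + θ i * s j) ^ 2 = ∑ c, y c ^ 2 + ∑ j, s j ^ 2 := by
  have hexp : ∀ i j, (ι y (i, j) + θ i * s j) ^ 2 =
      ι y (i, j) ^ 2 + (2 * s j * (θ i * ι y (i, j)) + θ i ^ 2 * s j ^ 2) := fun i j => by ring
  simp only [hexp, Finset.sum_add_distrib]
  rw [← hι, Fintype.sum_prod_type, Finset.sum_comm (f := fun i j => 2 * s j * (θ i * ι y (i, j)))]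
  simp only [← Finset.mul_sum, ← Finset.sum_mul, hιθ, hθ]
  simp

theorem measurePreserving_section (hd : d + m = n * m) :
    MeasurePreserving fun (z : (Fin d → ℝ) × (Fin m → ℝ)) (i : Fin n) (j : Fin m) =>
      ι z.1 (i, j) + θ i * z.2 j := by
  let L : (Fin d → ℝ) × (Fin m → ℝ) →ₗ[ℝ] (Fin n → Fin m → ℝ) :=
    { toFun := fun z i j => ι z.1 (i, j) + θ i * z.2 j
      map_add' := fun z w => by
        ext i j
        simp only [Prod.fst_add, Prod.snd_add, map_add, Pi.add_apply]
        ring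
      map_smul' := fun c z => by
        ext i j
        simp only [Prod.smul_fst, Prod.smul_snd, map_smul, Pi.smul_apply, smul_eq_mul,
          RingHom.id_apply]
        ring }
  have hLsq : ∀ z, ∑ i, ∑ j, L z i j ^ 2 = ∑ c, z.1 c ^ 2 + ∑ j, z.2 j ^ 2 := fun z =>
    sum_sq_add_smul hθ hι hιθ z.1 z.2
  have hinj : Function.Injective L := by
    refine (injective_iff_map_eq_zero L).2 fun z hz => ?_
    have h := hLsq z
    simp only [hz, Pi.zero_apply, ne_eq, OfNat.ofNat_ne_zero, not_false_eq_true, zero_pow,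
      Finset.sum_const_zero] at h
    have h1 : 0 ≤ ∑ c, z.1 c ^ 2 := Finset.sum_nonneg fun _ _ => sq_nonneg _
    have h2 : 0 ≤ ∑ j, z.2 j ^ 2 := Finset.sum_nonneg fun _ _ => sq_nonneg _
    have e1 : ∑ c, z.1 c ^ 2 = 0 := by linarith
    have e2 : ∑ j, z.2 j ^ 2 = 0 := by linarith
    rw [Finset.sum_eq_zero_iff_of_nonneg fun _ _ => sq_nonneg _] at e1 e2
    ext c
    · simpa using e1 c (Finset.mem_univ c)
    · simpa using e2 c (Finset.mem_univ c)
  have hHaar : (volume : Measure ((Fin d → ℝ) × (Fin m → ℝ))).IsAddHaarMeasure :=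
    Measure.prod.instIsAddHaarMeasure volume volume
  refine measurePreserving_of_lintegral_eq_one (LinearMap.linearEquivOfInjective L hinj
    (by simp [Module.finrank_pi_fintype, hd])) (g := fun x => ∏ i, gaussDensity (x i))
    (Finset.measurable_prod _ fun i _ => measurable_gaussDensity.comp (measurable_pi_apply i)) ?_ ?_
  · have : ∀ z, ∏ i, gaussDensity (L z i) = gaussDensity z.1 * gaussDensity z.2 := fun z => by
      simp only [gaussDensity]
      rw [← ENNReal.ofReal_prod_of_nonneg fun _ _ => (exp_pos _).le, ← Real.exp_sum,
        ← ENNReal.ofReal_mul (exp_pos _).le, ← Real.exp_add, ← mul_add, ← hLsq, Finset.mul_sum]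
    simp only [LinearMap.linearEquivOfInjective_apply, this]
    rw [Measure.volume_eq_prod, lintegral_prod_mul measurable_gaussDensity.aemeasurable
      measurable_gaussDensity.aemeasurable, lintegral_gaussDensity, lintegral_gaussDensity, one_mul]
  · rw [lintegral_prod_pi n measurable_gaussDensity, lintegral_gaussDensity, one_pow]

/-- A density more peaked than the standard Gaussian has integral at least one on the block
hyperplane parametrized by `ι`. -/
theorem Peaked.one_le_lintegral_section (hd : d + m = n * m) {Φ : (Fin n → Fin m → ℝ) → ℝ≥0∞}
    (hΦm : Measurable Φ) (hΦe : ∀ x, Φ (-x) = Φ x) (hΦ : LogConc Φ)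
    (hpk : Peaked Φ fun x => ∏ i, gaussDensity (x i)) :
    1 ≤ ∫⁻ y, Φ fun i j => ι y (i, j) := by
  set I := ∫⁻ y, Φ fun i j => ι y (i, j)
  have hJ := measurePreserving_section hθ hι hιθ hd
  have hθJ : ∀ y s j, ∑ i, θ i * (ι y (i, j) + θ i * s) = s := fun y s j => by
    simp only [mul_add, Finset.sum_add_distrib, hιθ, zero_add, ← mul_assoc, ← sq,
      ← Finset.sum_mul, hθ, one_mul]
  have hsec : ∀ s : Fin m → ℝ, ∫⁻ y, Φ (fun i j => ι y (i, j) + θ i * s j) ≤ I := by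
    have hlc : LogConc fun s : Fin m → ℝ => ∫⁻ y, Φ (fun i j => ι y (i, j) + θ i * s j) := by
      refine integralLogConc_real.pi d _
        (fun z : (Fin m → ℝ) × (Fin d → ℝ) => Φ fun i j => ι z.2 (i, j) + θ i * z.1 j)
        (fun s => hΦm.comp (hJ.measurable.comp measurable_prodMk_right)) ?_
      intro x y a b ha hb hab
      refine (hΦ _ _ a b ha hb hab).trans_eq ?_
      congr 1
      ext i j
      simp only [Pi.add_apply, Pi.smul_apply, smul_eq_mul, Prod.fst_add, Prod.snd_add,
        Prod.smul_fst, Prod.smul_snd, map_add, map_smul]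
      ring
    intro s
    have := hlc.le_smul (fun s => by
      rw [← lintegral_neg_eq_self]
      refine lintegral_congr fun y => ?_
      rw [← hΦe]
      congr 1
      ext i j
      simp only [Pi.neg_apply, map_neg]
      ring) s le_rfl zero_le_one
    simpa [I] using this
  have hε : ∀ ε : ℝ, 0 < ε → ENNReal.ofReal (exp (-π * (m * ε ^ 2))) ≤ I := by
    intro ε hε
    set B : Set (Fin m → ℝ) := Set.univ.pi fun _ => Set.Icc (-ε) ε with hB
    have hBm : MeasurableSet B := MeasurableSet.univ_pi fun _ => measurableSet_Icc
    have hmemB : ∀ s, s ∈ B ↔ ∀ j, |s j| ≤ ε := fun s => by 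
      simp only [hB, Set.mem_univ_pi, Set.mem_Icc, abs_le]
    have hBvol : volume B = ENNReal.ofReal (2 * ε) ^ m := by
      rw [hB, volume_pi_pi]
      simp [two_mul]
    have hB0 : volume B ≠ 0 := by
      rw [hBvol]
      exact pow_ne_zero _ (by simpa using hε)
    have hBtop : volume B ≠ ∞ := by
      rw [hBvol]
      exact ENNReal.pow_ne_top ENNReal.ofReal_ne_top
    set S : (Fin n → Fin m → ℝ) →ₗ[ℝ] (Fin m → ℝ) := ∑ i, θ i • LinearMap.proj i with hS
    have hSJ : ∀ y s, S (fun i j => ι y (i, j) + θ i * s j) = s := fun y s => by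
      ext j
      simp [hS, hθJ]
    set F : (Fin n → Fin m → ℝ) → ℝ≥0∞ := fun x => B.indicator 1 (S x) with hF
    have hBconv : Convex ℝ B := convex_pi fun _ _ => convex_Icc _ _
    have hFm : Measurable F := (measurable_one.indicator hBm).comp
      S.continuous_of_finiteDimensional.measurable
    have hBneg : ∀ s, -s ∈ B ↔ s ∈ B := fun s => by simp [hmemB]
    have hFe : ∀ x, F (-x) = F x := fun x => by
      by_cases h : S x ∈ B
      · simp [hF, (hBneg _).2 h, h]
      · simp [hF, mt (hBneg _).1 h, h]
    have hF1 : ∀ x, F x ≤ 1 := fun x => Set.indicator_le_self' (by simp) _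
    have hFlc : LogConc F := by
      refine LogConc.comp_linear (g := B.indicator 1) ?_ S
      intro x y a b ha hb hab
      by_cases hx : x ∈ B
      · by_cases hy : y ∈ B
        · simp [hx, hy, hBconv hx hy ha.le hb.le hab]
        · simp [hy, ENNReal.zero_rpow_of_pos hb]
      · simp [hx, ENNReal.zero_rpow_of_pos ha]
    have hpkF := hpk F hFm hFe hFlc hF1
    have hgm : Measurable fun x : Fin n → Fin m → ℝ => ∏ i, gaussDensity (x i) :=
      Finset.measurable_prod _ fun i _ => measurable_gaussDensity.comp (measurable_pi_apply i)
    rw [← hJ.lintegral_comp (f := fun x => F x * ∏ i, gaussDensity (x i)) (hFm.mul hgm),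
      ← hJ.lintegral_comp (f := fun x => F x * Φ x) (hFm.mul hΦm)] at hpkF
    have hprod : ∀ z : (Fin d → ℝ) × (Fin m → ℝ),
        ∏ i, gaussDensity (fun j => ι z.1 (i, j) + θ i * z.2 j)
          = gaussDensity z.1 * gaussDensity z.2 := fun z => by
      simp only [gaussDensity]
      rw [← ENNReal.ofReal_prod_of_nonneg fun _ _ => (exp_pos _).le, ← Real.exp_sum,
        ← ENNReal.ofReal_mul (exp_pos _).le, ← Real.exp_add, ← mul_add,
        ← sum_sq_add_smul hθ hι hιθ, Finset.mul_sum]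
    have hlow : ENNReal.ofReal (exp (-π * (m * ε ^ 2))) * volume B ≤
        ∫⁻ z : (Fin d → ℝ) × (Fin m → ℝ), F (fun i j => ι z.1 (i, j) + θ i * z.2 j) *
          ∏ i, gaussDensity (fun j => ι z.1 (i, j) + θ i * z.2 j) := by
      simp only [hprod, hF, hSJ]
      calc _ = (∫⁻ y : Fin d → ℝ, gaussDensity y) *
            ∫⁻ s, B.indicator (fun _ => ENNReal.ofReal (exp (-π * (m * ε ^ 2)))) s := by
            rw [lintegral_gaussDensity, one_mul, lintegral_indicator_const hBm]
        _ = ∫⁻ z : (Fin d → ℝ) × (Fin m → ℝ), gaussDensity z.1 *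
            B.indicator (fun _ => ENNReal.ofReal (exp (-π * (m * ε ^ 2)))) z.2 := by
            rw [Measure.volume_eq_prod, lintegral_prod_mul measurable_gaussDensity.aemeasurable
              (measurable_const.indicator hBm).aemeasurable]
        _ ≤ _ := by
            refine lintegral_mono fun z => ?_
            by_cases hz : z.2 ∈ B
            · simp only [hz, Set.indicator_of_mem, Pi.one_apply, one_mul]
              refine mul_le_mul_right (ENNReal.ofReal_le_ofReal (Real.exp_le_exp.2 ?_)) _
              have : ∑ j, z.2 j ^ 2 ≤ ∑ _j : Fin m, ε ^ 2 := Finset.sum_le_sum fun j _ =>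
                sq_le_sq' (abs_le.1 ((hmemB _).1 hz j)).1 (abs_le.1 ((hmemB _).1 hz j)).2
              simp only [Finset.sum_const, Finset.card_univ, Fintype.card_fin, nsmul_eq_mul] at this
              nlinarith [pi_pos]
            · simp [hz]
    have hup : ∫⁻ z : (Fin d → ℝ) × (Fin m → ℝ), F (fun i j => ι z.1 (i, j) + θ i * z.2 j) *
        Φ (fun i j => ι z.1 (i, j) + θ i * z.2 j) ≤ I * volume B := by
      have hm : Measurable fun z : (Fin d → ℝ) × (Fin m → ℝ) =>
          F (fun i j => ι z.1 (i, j) + θ i * z.2 j) * Φ (fun i j => ι z.1 (i, j) + θ i * z.2 j) :=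
        (hFm.mul hΦm).comp hJ.measurable
      rw [Measure.volume_eq_prod, lintegral_prod_symm _ hm.aemeasurable]
      simp only [hF, hSJ]
      calc _ ≤ ∫⁻ s, B.indicator (fun _ => I) s := by
            refine lintegral_mono fun s => ?_
            by_cases hs : s ∈ B
            · simpa [hs] using hsec s
            · simp [hs]
        _ = _ := lintegral_indicator_const hBm _
    exact (ENNReal.mul_le_mul_iff_left hB0 hBtop).1 (hlow.trans (hpkF.trans hup))
  have hcont : Tendsto (fun ε : ℝ => ENNReal.ofReal (exp (-π * (m * ε ^ 2)))) (nhdsWithin 0 (Set.Ioi 0))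
      (nhds 1) := by
    have : Continuous fun ε : ℝ => ENNReal.ofReal (exp (-π * (m * ε ^ 2))) :=
      ENNReal.continuous_ofReal.comp (by fun_prop)
    simpa using (this.tendsto 0).mono_left nhdsWithin_le_nhds
  exact le_of_tendsto hcont (eventually_mem_nhdsWithin.mono hε)

end

theorem expProfile_two_mul_abs (t : ℝ) :
    expProfile 2 (√π * |t|) = ENNReal.ofReal (exp (-π * t ^ 2)) := by
  rw [expProfile_of_ne_top (by simp), abs_mul, abs_abs, abs_of_nonneg (Real.sqrt_nonneg _),
    ENNReal.toReal_ofNat, Real.rpow_two, mul_pow, Real.sq_sqrt pi_pos.le, sq_abs, neg_mul]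

theorem prod_expProfile_two {m : ℕ} (x : Fin m → ℝ) :
    ∏ j, expProfile 2 (√π * |x j|) = gaussDensity x := by
  simp only [expProfile_two_mul_abs, gaussDensity]
  rw [← ENNReal.ofReal_prod_of_nonneg fun _ _ => (exp_pos _).le, ← Real.exp_sum, Finset.mul_sum]

theorem lintegral_expProfile_two : ∫⁻ t : ℝ, expProfile 2 (√π * |t|) = 1 := by
  simp only [expProfile_two_mul_abs]
  rw [← ofReal_integral_eq_lintegral_ofReal (integrable_exp_neg_mul_sq pi_pos)
    (Eventually.of_forall fun t => (exp_pos _).le), integral_gaussian, div_self pi_pos.ne',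
    Real.sqrt_one, ENNReal.ofReal_one]

theorem measurable_expProfile_mul_lqNormE {m : ℕ} {q : ℝ≥0∞} (hq : 1 ≤ q) (p : ℝ≥0∞) (c : ℝ) :
    Measurable fun x : Fin m → ℝ => expProfile p (c * lqNormE m q x) :=
  (measurable_expProfile p).comp ((continuous_lqNormE hq).measurable.const_mul c)

theorem lqNormE_neg {m : ℕ} {q : ℝ≥0∞} (hq : 1 ≤ q) (x : Fin m → ℝ) :
    lqNormE m q (-x) = lqNormE m q x := by
  simpa using lqNormE_smul hq (-1) x

theorem exists_peaked_gaussDensity {m : ℕ} (hm : m ≠ 0) {p q : ℝ≥0∞} (hq2 : 2 ≤ q) (hqp : q ≤ p)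
    (n : ℕ) : ∃ α : ℝ, 0 < α ∧ ∫⁻ x : Fin m → ℝ, expProfile p (α * lqNormE m q x) = 1 ∧
      Peaked (fun x : Fin n → Fin m → ℝ => ∏ i, expProfile p (α * lqNormE m q (x i)))
        (fun x => ∏ i, gaussDensity (x i)) := by
  have : Nonempty (Fin m) := Fin.pos_iff_nonempty.1 (Nat.pos_of_ne_zero hm)
  have hq : 1 ≤ q := one_le_two.trans hq2
  have hp : 1 ≤ p := hq.trans hqp
  have habs0 : ∀ x : ℝ, 0 ≤ |x| := abs_nonneg
  have habs_smul : ∀ s x : ℝ, |s • x| = |s| * |x| := fun s x => abs_mul s x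
  have hball : {x : ℝ | |x| ≤ 1} = Set.Icc (-1) 1 := by ext; simp [abs_le]
  have hpos : volume {x : ℝ | |x| ≤ 1} ≠ 0 := by simp [hball]
  have hfin : volume {x : ℝ | |x| ≤ 1} ≠ ∞ := by simp [hball]
  obtain ⟨β, hβ, hβ1⟩ := exists_lintegral_expProfile_eq_one measurable_abs habs0 habs_smul hpos
    (lintegral_expProfile_abs_ne_top hq2)
  obtain ⟨α, hα, hα1⟩ := exists_lintegral_expProfile_eq_one (continuous_lqNormE hq).measurable
    (lqNormE_nonneg hq) (lqNormE_smul hq) (volume_lqNormE_le_ne_zero hq)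
    (lintegral_expProfile_lqNormE_ne_top (m := m) (hq2.trans hqp) hq)
  refine ⟨α, hα, hα1, ?_⟩
  have hlcr : ∀ {r : ℝ≥0∞} {c : ℝ}, 1 ≤ r → 0 ≤ c → LogConc fun t : ℝ => expProfile r (c * |t|) :=
    fun hr hc => LogConc.expProfile_comp hr habs0 abs_add_le habs_smul hc
  have hmr : ∀ (r : ℝ≥0∞) (c : ℝ), Measurable fun t : ℝ => expProfile r (c * |t|) :=
    fun r c => (measurable_expProfile r).comp (measurable_abs.const_mul c)
  have h1 : Peaked (fun t : ℝ => expProfile q (β * |t|)) (fun t => expProfile 2 (√π * |t|)) :=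
    peaked_expProfile measurable_abs habs0 habs_smul (fun _ => abs_eq_zero.1) hfin hpos hq2 hβ
      (Real.sqrt_pos.2 pi_pos) hβ1 lintegral_expProfile_two
  have h2 := h1.pi integralLogConc_real (hmr _ _) (hmr _ _) (fun _ => by rw [abs_neg])
    (fun _ => by rw [abs_neg]) (hlcr hq hβ.le) (hlcr one_le_two (Real.sqrt_nonneg _)) hβ1.le
    lintegral_expProfile_two.le m
  have hprod : ∀ x : Fin m → ℝ, ∏ j, expProfile q (β * |x j|) = expProfile q (β * lqNormE m q x) := by
    intro x
    rw [← prod_expProfile_mul hq]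
    refine Finset.prod_congr rfl fun j _ => ?_
    rw [← expProfile_abs q (β * x j), ← expProfile_abs q (β * |x j|), abs_mul, abs_mul, abs_abs]
  have hβ1' : ∫⁻ x : Fin m → ℝ, expProfile q (β * lqNormE m q x) = 1 := by
    simp only [← hprod]
    rw [lintegral_prod_pi m (hmr q β), hβ1, one_pow]
  simp only [hprod, prod_expProfile_two] at h2
  have h3 := (peaked_expProfile (continuous_lqNormE hq).measurable (lqNormE_nonneg hq)
    (lqNormE_smul hq) (eq_zero_of_lqNormE_eq_zero hq) (volume_lqNormE_le_ne_top hq)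
    (volume_lqNormE_le_ne_zero hq) hqp hα hβ hα1 hβ1').trans h2
  have hglc : LogConc (gaussDensity : (Fin m → ℝ) → ℝ≥0∞) := by
    simp only [funext fun x : Fin m → ℝ => (prod_expProfile_two x).symm]
    exact (hlcr one_le_two (Real.sqrt_nonneg _)).prod_pi Finset.univ
  exact h3.pi (integralLogConc_real.pi m) (measurable_expProfile_mul_lqNormE hq p α)
    measurable_gaussDensity (fun x => by rw [lqNormE_neg hq]) (fun x => by simp [gaussDensity])
    (LogConc.expProfile_comp hp (lqNormE_nonneg hq) (lqNormE_add_le hq) (lqNormE_smul hq) hα.le)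
    hglc hα1.le lintegral_gaussDensity.le n

section

variable {m n : ℕ} {p q : ℝ≥0∞} (hp : 1 ≤ p) (hq : 1 ≤ q)
include hp hq

theorem lpBallE_eq_setOf : lpBallE m n p (lqNormE m q) =
    {x | lqNormE n p (fun i => lqNormE m q fun j => x (i, j)) ≤ 1} := by
  ext x
  have h0 : ∀ i, 0 ≤ lqNormE m q fun j => x (i, j) := fun i => lqNormE_nonneg hq _
  by_cases h : p = ⊤
  · subst h
    simp only [lpBallE, if_true, Set.mem_ofPred_eq]
    refine ⟨fun hx => ?_, fun hx i => (le_abs_self _).trans ((abs_le_lqNormE hp _ i).trans hx)⟩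
    simp only [lqNormE, if_true]
    refine Real.iSup_le (fun i => ?_) zero_le_one
    rw [abs_of_nonneg]
    · simpa [lqNormE] using hx i
    · simpa [lqNormE] using h0 i
  · have hpos : 0 < p.toReal := zero_lt_one.trans_le (one_le_toReal hp h)
    simp only [lpBallE, if_neg h, Set.mem_ofPred_eq]
    conv_rhs => rw [lqNormE, if_neg h]
    simp only [abs_of_nonneg (h0 _)]
    have hS : 0 ≤ ∑ i, (lqNormE m q fun j => x (i, j)) ^ p.toReal :=
      Finset.sum_nonneg fun i _ => Real.rpow_nonneg (h0 i) _
    refine ⟨fun hx => Real.rpow_le_one hS hx (by positivity), fun hx => ?_⟩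
    have := Real.rpow_le_one (Real.rpow_nonneg hS _) hx hpos.le
    rwa [← Real.rpow_mul hS, one_div_mul_cancel hpos.ne', Real.rpow_one] at this

theorem measurable_lqNormE_lqNormE :
    Measurable fun x : Fin n → Fin m → ℝ => lqNormE n p fun i => lqNormE m q (x i) :=
  (continuous_lqNormE hp).measurable.comp (measurable_pi_lambda _ fun i =>
    (continuous_lqNormE hq).measurable.comp (measurable_pi_apply i))

theorem lqNormE_lqNormE_smul (s : ℝ) (x : Fin n → Fin m → ℝ) :
    lqNormE n p (fun i => lqNormE m q ((s • x) i)) =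
      |s| * lqNormE n p fun i => lqNormE m q (x i) := by
  have : (fun i => lqNormE m q ((s • x) i)) = |s| • fun i => lqNormE m q (x i) := by
    ext i
    simp [lqNormE_smul hq]
  rw [this, lqNormE_smul hp, abs_abs]

theorem abs_le_lqNormE_lqNormE (x : Fin n → Fin m → ℝ) (i : Fin n) (j : Fin m) :
    |x i j| ≤ lqNormE n p fun i => lqNormE m q (x i) :=
  (abs_le_lqNormE hq (x i) j).trans ((le_abs_self _).trans
    (abs_le_lqNormE hp (fun i => lqNormE m q (x i)) i))

theorem volume_lpBallE_ne_top : volume (lpBallE m n p (lqNormE m q)) ≠ ∞ := by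
  refine ne_top_of_le_ne_top
    (measure_closedBall_lt_top (x := (0 : Fin n × Fin m → ℝ)) (r := 1)).ne
    (measure_mono fun x hx => ?_)
  rw [lpBallE_eq_setOf hp hq] at hx
  rw [mem_closedBall_zero_iff, pi_norm_le_iff_of_nonneg zero_le_one]
  exact fun c => (abs_le_lqNormE_lqNormE hp hq (fun i j => x (i, j)) c.1 c.2).trans hx

end

theorem volume_lpBallE_le_volume_section {m n : ℕ} (hm : m ≠ 0) {p q : ℝ≥0∞} (hq2 : 2 ≤ q)
    (hqp : q ≤ p) {θ : Fin n → ℝ} (hθ : ∑ i, θ i ^ 2 = 1)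
    {ι : (Fin (m * (n - 1)) → ℝ) →ₗ[ℝ] (Fin n × Fin m → ℝ)}
    (hι : IsEuclParam m n (m * (n - 1)) ι (blockHyp m n θ)) :
    volume (lpBallE m (n - 1) p (lqNormE m q)) ≤
      volume (⇑ι ⁻¹' (lpBallE m n p (lqNormE m q) ∩ blockHyp m n θ)) := by
  have hq : 1 ≤ q := one_le_two.trans hq2
  have hp : 1 ≤ p := hq.trans hqp
  have hn : n ≠ 0 := by
    rintro rfl
    simp at hθ
  have hd : m * (n - 1) + m = n * m := by
    rw [← Nat.mul_succ, Nat.succ_eq_add_one, Nat.sub_add_cancel (Nat.one_le_iff_ne_zero.2 hn),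
      mul_comm]
  have hmem : ∀ y, ι y ∈ blockHyp m n θ := fun y => hι.2 ▸ Set.mem_range_self y
  have hpre : ⇑ι ⁻¹' (lpBallE m n p (lqNormE m q) ∩ blockHyp m n θ) =
      {y | lqNormE n p (fun i => lqNormE m q fun j => ι y (i, j)) ≤ 1} := by
    rw [lpBallE_eq_setOf hp hq]
    ext y
    simp [hmem y]
  obtain ⟨α, hα, hα1, hpk⟩ := exists_peaked_gaussDensity hm hq2 hqp n
  have hlc : LogConc fun x : Fin m → ℝ => expProfile p (α * lqNormE m q x) :=
    LogConc.expProfile_comp hp (lqNormE_nonneg hq) (lqNormE_add_le hq) (lqNormE_smul hq) hα.le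
  have hsec := Peaked.one_le_lintegral_section hθ hι.1 hmem hd
    (Φ := fun x : Fin n → Fin m → ℝ => ∏ i, expProfile p (α * lqNormE m q (x i)))
    (Finset.measurable_prod _ fun i _ =>
      (measurable_expProfile_mul_lqNormE hq p α).comp (measurable_pi_apply i))
    (fun x => by simp only [Pi.neg_apply, lqNormE_neg hq]) (hlc.prod_pi Finset.univ) hpk
  have hprod : ∀ (k : ℕ) (x : Fin k → Fin m → ℝ), ∏ i, expProfile p (α * lqNormE m q (x i)) =
      expProfile p (α * lqNormE k p fun i => lqNormE m q (x i)) :=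
    fun k x => prod_expProfile_mul hp α fun i => lqNormE m q (x i)
  have hfull : ∫⁻ x : Fin (n - 1) × Fin m → ℝ,
      expProfile p (α * lqNormE (n - 1) p fun i => lqNormE m q fun j => x (i, j)) = 1 := by
    have := (measurePreserving_curry (n - 1) m).lintegral_comp
      (f := fun x => ∏ i, expProfile p (α * lqNormE m q (x i)))
      (Finset.measurable_prod _ fun i _ =>
        (measurable_expProfile_mul_lqNormE hq p α).comp (measurable_pi_apply i))
    rw [lintegral_prod_pi _ (measurable_expProfile_mul_lqNormE hq p α), hα1, one_pow] at this
    simpa only [hprod] using this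
  simp only [hprod] at hsec
  by_cases hb : volume (⇑ι ⁻¹' (lpBallE m n p (lqNormE m q) ∩ blockHyp m n θ)) = ∞
  · rw [hb]
    exact le_top
  rw [hpre] at hb ⊢
  have hιm : Measurable fun (y : Fin (m * (n - 1)) → ℝ) i j => ι y (i, j) :=
    measurable_pi_lambda _ fun i => measurable_pi_lambda _ fun j =>
      (measurable_pi_apply (i, j)).comp ι.continuous_of_finiteDimensional.measurable
  have hcm : Measurable fun (x : Fin (n - 1) × Fin m → ℝ) i j => x (i, j) :=
    (measurePreserving_curry (n - 1) m).measurable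
  have hM₁ := (measurable_lqNormE_lqNormE (m := m) (n := n) hp hq).comp hιm
  have hM₂ := (measurable_lqNormE_lqNormE (m := m) (n := n - 1) hp hq).comp hcm
  have hball := volume_lpBallE_ne_top (m := m) (n := n - 1) hp hq
  rw [lpBallE_eq_setOf hp hq] at hball ⊢
  have hsm₁ : ∀ (s : ℝ) (y : Fin (m * (n - 1)) → ℝ),
      lqNormE n p (fun i => lqNormE m q fun j => ι (s • y) (i, j)) =
        |s| * lqNormE n p (fun i => lqNormE m q fun j => ι y (i, j)) := fun s y => by
    rw [map_smul]
    exact lqNormE_lqNormE_smul hp hq s fun i j => ι y (i, j)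
  have hsm₂ : ∀ (s : ℝ) (x : Fin (n - 1) × Fin m → ℝ),
      lqNormE (n - 1) p (fun i => lqNormE m q fun j => (s • x) (i, j)) =
        |s| * lqNormE (n - 1) p (fun i => lqNormE m q fun j => x (i, j)) :=
    fun s x => lqNormE_lqNormE_smul hp hq s fun i j => x (i, j)
  have key := lintegral_comp_gauge (ν₁ := volume) (ν₂ := volume) (d := m * (n - 1))
    (fun _ => lqNormE_nonneg hp _) (fun _ => lqNormE_nonneg hp _) hM₁ hM₂ hb hball
    (fun r hr => by simpa using volume_gauge_le hM₁ hsm₁ hr)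
    (fun r hr => by simpa [mul_comm] using volume_gauge_le hM₂ hsm₂ hr)
    ((measurable_expProfile p).comp (measurable_const_mul α))
  simp only [Function.comp_apply, hfull, mul_one] at key
  rw [← key]
  exact le_mul_of_one_le_right' hsec

theorem volume_lpBallE_top {m : ℕ} {q : ℝ≥0∞} (hq : 1 ≤ q) (k : ℕ) :
    volume (lpBallE m k ⊤ (lqNormE m q)) = volume {z : Fin m → ℝ | lqNormE m q z ≤ 1} ^ k := by
  have hK : MeasurableSet {z : Fin m → ℝ | lqNormE m q z ≤ 1} :=
    measurableSet_le (continuous_lqNormE hq).measurable measurable_const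
  have hpre : lpBallE m k ⊤ (lqNormE m q) =
      (fun (x : Fin k × Fin m → ℝ) (i : Fin k) (j : Fin m) => x (i, j)) ⁻¹'
        Set.univ.pi fun _ => {z : Fin m → ℝ | lqNormE m q z ≤ 1} := by
    ext x
    simp [lpBallE]
  rw [hpre, (measurePreserving_curry k m).measure_preimage
    (MeasurableSet.univ_pi fun _ => hK).nullMeasurableSet, volume_pi_pi]
  simp

/-- **Sections of `B_p^n(ℓ_q^m)` for `2 ≤ q ≤ p ≤ ∞`.** For every unit vector `θ` of `ℝ^n`,
`|B_p^n(ℓ_q^m) ∩ H_θ| ≥ |B_p^{n-1}(ℓ_q^m)|`, the `m(n-1)`-dimensional Lebesgue measure of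
the section being computed via a Euclidean isometric parametrization `ι` of `H_θ`. In
particular, the set `K = B_q^m(ℝ)` satisfies `|K^n ∩ H_θ| ≥ |K|^{n-1}`. -/
theorem sections_lower_bound_lq (m n : ℕ) (q p : ℝ≥0∞) (hq2 : 2 ≤ q) (hqp : q ≤ p)
    (θ : Fin n → ℝ) (hθ : ∑ i, θ i ^ 2 = 1)
    (ι : (Fin (m * (n - 1)) → ℝ) →ₗ[ℝ] (Fin n × Fin m → ℝ))
    (hι : IsEuclParam m n (m * (n - 1)) ι (blockHyp m n θ)) :
    volume (lpBallE m (n - 1) p (lqNormE m q)) ≤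
        volume (⇑ι ⁻¹' (lpBallE m n p (lqNormE m q) ∩ blockHyp m n θ)) ∧
      volume {z : Fin m → ℝ | lqNormE m q z ≤ 1} ^ (n - 1) ≤
        volume (⇑ι ⁻¹'
          ({x : Fin n × Fin m → ℝ | ∀ i : Fin n, lqNormE m q (fun j => x (i, j)) ≤ 1} ∩
            blockHyp m n θ)) := by
  have hq : 1 ≤ q := one_le_two.trans hq2
  have key : ∀ r : ℝ≥0∞, q ≤ r → volume (lpBallE m (n - 1) r (lqNormE m q)) ≤
      volume (⇑ι ⁻¹' (lpBallE m n r (lqNormE m q) ∩ blockHyp m n θ)) := by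
    intro r hr
    rcases eq_or_ne m 0 with rfl | hm
    · have hpre : ⇑ι ⁻¹' (lpBallE 0 n r (lqNormE 0 q) ∩ blockHyp 0 n θ) = Set.univ := by
        ext y
        rw [lpBallE_eq_setOf (hq.trans hr) hq]
        have h0 : ∀ {k : ℕ} {s : ℝ≥0∞}, 1 ≤ s → lqNormE k s 0 = 0 := fun hs => by
          simpa using lqNormE_smul hs 0 0
        have hx : (fun i => lqNormE 0 q fun j => ι y (i, j)) = 0 := by
          ext i
          rw [Subsingleton.elim (fun j => ι y (i, j)) 0, h0 hq, Pi.zero_apply]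
        simp [blockHyp, hx, h0 (hq.trans hr)]
      rw [hpre]
      refine (measure_mono (Set.subset_univ _)).trans_eq ?_
      rw [← Set.pi_univ Set.univ, ← Set.pi_univ Set.univ, volume_pi_pi, volume_pi_pi]
      simp
    · exact volume_lpBallE_le_volume_section hm hq2 hr hθ hι
  refine ⟨key p hqp, ?_⟩
  have h := key ⊤ le_top
  rw [volume_lpBallE_top hq] at h
  simpa only [lpBallE, if_true] using h
end
end
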